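/- arXiv:1207.3429 — 3 statements merged into one kernel-verified Lean document; each statement's English description precedes it below -/
import Mathlib

section
/- Let n ≥ 1 and let Φ⁺ be the positive roots of type C_n in ℝ^n. The Lebesgue volume of the positive root polytope 𝒫⁺ = conv(Φ⁺ ∪ {0}) is C(2n, n)/n!, where C(2n,n) is the central binomial coefficient. (Equivalently, vol(𝒫⁺)/vol(𝒫) = C(2n,n)/2^{2n}, where 𝒫 = conv(Φ) has volume 4^n/n!.) -/
open MeasureTheory ProbabilityTheory Finset Pointwise

/-- The self-convolution of the central binomial coefficients is `4 ^ n`. -/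
lemma sum_antidiagonal_centralBinom_mul_centralBinom (n : ℕ) :
    ∑ p ∈ antidiagonal n, p.1.centralBinom * p.2.centralBinom = 4 ^ n := by
  induction n with
  | zero => simp
  | succ n ih =>
    have symm (m : ℕ) : ∑ p ∈ antidiagonal m, p.2 * (p.1.centralBinom * p.2.centralBinom) =
        ∑ p ∈ antidiagonal m, p.1 * (p.1.centralBinom * p.2.centralBinom) := by
      rw [← Finset.Nat.sum_antidiagonal_swap]
      exact sum_congr rfl fun p _ => by simp [mul_comm]
    have weighted (m : ℕ) : m * ∑ p ∈ antidiagonal m, p.1.centralBinom * p.2.centralBinom =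
        2 * ∑ p ∈ antidiagonal m, p.1 * (p.1.centralBinom * p.2.centralBinom) := by
      rw [two_mul]
      nth_rewrite 2 [← symm]
      rw [mul_sum, ← sum_add_distrib]
      refine sum_congr rfl fun p hp => ?_
      rw [← HasAntidiagonal.mem_antidiagonal.mp hp]
      ring
    have shift : ∑ p ∈ antidiagonal (n + 1), p.1 * (p.1.centralBinom * p.2.centralBinom) =
        4 * ∑ p ∈ antidiagonal n, p.1 * (p.1.centralBinom * p.2.centralBinom) +
          2 * ∑ p ∈ antidiagonal n, p.1.centralBinom * p.2.centralBinom := by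
      rw [Finset.Nat.sum_antidiagonal_succ, mul_sum, mul_sum, ← sum_add_distrib]
      simp only [zero_mul, zero_add]
      refine sum_congr rfl fun p _ => ?_
      rw [← mul_assoc, Nat.succ_mul_centralBinom_succ]
      ring
    have h := weighted (n + 1)
    rw [shift] at h
    have h' := weighted n
    refine Nat.eq_of_mul_eq_mul_left n.succ_pos ?_
    rw [Nat.succ_eq_add_one, h, pow_succ, ← ih]
    linarith

/-- A nonnegative sequence whose self-convolution is constantly `1` is
`centralBinom n / 4 ^ n`. -/
lemma eq_centralBinom_div_of_sum_antidiagonal_eq_one {p : ℕ → ℝ} (hp : 0 ≤ p 0)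
    (h : ∀ n, ∑ q ∈ antidiagonal n, p q.1 * p q.2 = 1) (n : ℕ) :
    p n = n.centralBinom / 4 ^ n := by
  have key : PowerSeries.mk p ^ 2 =
      PowerSeries.mk (fun n : ℕ => (n.centralBinom : ℝ) / 4 ^ n) ^ 2 := by
    ext n
    simp only [sq, PowerSeries.coeff_mul, PowerSeries.coeff_mk]
    rw [h, eq_comm]
    have : ∀ q ∈ antidiagonal n,
        (q.1.centralBinom : ℝ) / 4 ^ q.1 * (q.2.centralBinom / 4 ^ q.2) =
          ((q.1.centralBinom * q.2.centralBinom : ℕ) : ℝ) / 4 ^ n := by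
      intro q hq
      rw [← HasAntidiagonal.mem_antidiagonal.mp hq, pow_add]
      push_cast
      field_simp
    rw [sum_congr rfl this, ← sum_div, ← Nat.cast_sum,
      sum_antidiagonal_centralBinom_mul_centralBinom]
    simp
  rcases sq_eq_sq_iff_eq_or_eq_neg.mp key with h' | h'
  · simpa using congrArg (PowerSeries.coeff n) h'
  · have := congrArg (PowerSeries.coeff 0) h'
    simp at this
    linarith

/-- The sequences whose first `n` partial sums are nonnegative. -/
def nonnegWalks (n : ℕ) : Set (ℕ → ℝ) := {x | ∀ m ≤ n, 0 ≤ ∑ i ∈ range m, x i}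

lemma measurableSet_nonnegWalks (n : ℕ) : MeasurableSet (nonnegWalks n) := by
  simp only [nonnegWalks, measurableSet_setOfPred]
  fun_prop

/-- Two events depending on disjoint finite sets of coordinates are independent under a product
measure. -/
lemma infinitePi_inter_eq_mul_of_dependsOn {μ : Measure ℝ} [IsProbabilityMeasure μ]
    {S T : Finset ℕ} (hST : Disjoint S T) {A B : Set (ℕ → ℝ)} (hA : MeasurableSet A)
    (hB : MeasurableSet B) (hAS : DependsOn (· ∈ A) (S : Set ℕ))
    (hBT : DependsOn (· ∈ B) (T : Set ℕ)) :
    Measure.infinitePi (fun _ : ℕ => μ) (A ∩ B) =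
      Measure.infinitePi (fun _ : ℕ => μ) A * Measure.infinitePi (fun _ : ℕ => μ) B := by
  have extend (U : Finset ℕ) {C : Set (ℕ → ℝ)} (hC : MeasurableSet C)
      (hCU : DependsOn (· ∈ C) (U : Set ℕ)) :
      ∃ D : Set (U → ℝ), MeasurableSet D ∧ C = (fun x (i : U) => x i) ⁻¹' D := by
    refine ⟨(fun r i => if h : i ∈ U then r ⟨i, h⟩ else 0) ⁻¹' C, ?_, ?_⟩
    · refine measurable_pi_lambda _ (fun i => ?_) hC
      by_cases h : i ∈ U <;> simp only [h, dite_true, dite_false] <;> fun_prop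
    · ext x
      refine iff_of_eq (hCU fun i hi => ?_)
      simp [mem_coe.mp hi]
  obtain ⟨A', hA', rfl⟩ := extend S hA hAS
  obtain ⟨B', hB', rfl⟩ := extend T hB hBT
  exact ((iIndepFun_infinitePi (P := fun _ : ℕ => μ) (X := fun _ x => x)
    fun _ => measurable_id).indepFun_finset S T hST (by fun_prop)).measure_inter_preimage_eq_mul
    _ _ hA' hB'

lemma measurePreserving_infinitePi_comp {μ : Measure ℝ} [IsProbabilityMeasure μ] {f : ℕ → ℕ}
    (hf : Function.Injective f) :
    MeasurePreserving (fun (x : ℕ → ℝ) i => x (f i)) (Measure.infinitePi fun _ : ℕ => μ)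
      (Measure.infinitePi fun _ : ℕ => μ) :=
  ⟨by fun_prop, Measure.map_infinitePi_infinitePi_of_inj hf⟩

lemma measurePreserving_infinitePi_neg {μ : Measure ℝ} [IsProbabilityMeasure μ]
    (hμ : μ.map Neg.neg = μ) :
    MeasurePreserving (fun (x : ℕ → ℝ) i => -x i) (Measure.infinitePi fun _ : ℕ => μ)
      (Measure.infinitePi fun _ : ℕ => μ) := by
  refine ⟨by fun_prop, ?_⟩
  rw [Measure.infinitePi_map_pi (f := fun _ (t : ℝ) => -t) _ (fun _ => measurable_neg)]
  exact congrArg Measure.infinitePi (funext fun _ => hμ)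

section SparreAndersen

variable {μ : Measure ℝ} [IsProbabilityMeasure μ]

lemma infinitePi_pos_partial_sums
    (hnull : ∀ m, 0 < m →
      Measure.infinitePi (fun _ : ℕ => μ) {x | ∑ i ∈ range m, x i = 0} = 0) (k : ℕ) :
    Measure.infinitePi (fun _ : ℕ => μ) {x | ∀ j < k, 0 < ∑ i ∈ Ico j k, x i} =
      Measure.infinitePi (fun _ : ℕ => μ) (nonnegWalks k) := by
  let f : ℕ → ℕ := fun i => if i < k then k - 1 - i else i
  have hf : Function.Injective f := by
    intro a b h
    simp only [f] at h
    split_ifs at h <;> omega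
  have hsum (x : ℕ → ℝ) (j : ℕ) (hj : j ≤ k) :
      ∑ i ∈ range (k - j), x (f i) = ∑ i ∈ Ico j k, x i := by
    rw [← sum_range_reflect, sum_Ico_eq_sum_range]
    refine sum_congr rfl fun i hi => ?_
    rw [mem_range] at hi
    congr 1
    simp only [f]
    split_ifs <;> omega
  rw [← (measurePreserving_infinitePi_comp hf).measure_preimage
    (measurableSet_nonnegWalks k).nullMeasurableSet]
  have hae : ∀ᵐ x ∂Measure.infinitePi (fun _ : ℕ => μ),
      ∀ m, 0 < m → ∑ i ∈ range m, x (f i) ≠ 0 := by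
    have : ∀ᵐ x ∂Measure.infinitePi (fun _ : ℕ => μ),
        ∀ m, 0 < m → ∑ i ∈ range m, x i ≠ 0 := by
      rw [ae_all_iff]
      intro m
      rcases m.eq_zero_or_pos with rfl | hm
      · simp
      · simpa [ae_iff, hm] using hnull m hm
    exact (measurePreserving_infinitePi_comp hf).quasiMeasurePreserving.ae this
  refine measure_congr ?_
  filter_upwards [hae] with x hx
  refine propext ⟨fun h m hm => ?_, fun h j hj => ?_⟩
  · rcases m.eq_zero_or_pos with rfl | hm0
    · simp
    · have := (h (k - m) (by omega)).le
      rwa [← hsum x _ (by omega), Nat.sub_sub_self hm] at this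
  · rw [← hsum x j hj.le]
    exact lt_of_le_of_ne (h (k - j) (by omega)) (hx _ (by omega)).symm

lemma infinitePi_nonpos_partial_sums_shift (hμ : μ.map Neg.neg = μ) (k m : ℕ) :
    Measure.infinitePi (fun _ : ℕ => μ) {x | ∀ j ≤ m, ∑ i ∈ range j, x (k + i) ≤ 0} =
      Measure.infinitePi (fun _ : ℕ => μ) (nonnegWalks m) := by
  rw [← ((measurePreserving_infinitePi_neg hμ).comp (measurePreserving_infinitePi_comp
    (add_right_injective k))).measure_preimage (measurableSet_nonnegWalks m).nullMeasurableSet]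
  congr 1
  ext x
  simp [nonnegWalks]

/-- Splitting a walk at the first time it reaches its maximum. -/
lemma sum_antidiagonal_infinitePi_nonnegWalks (hμ : μ.map Neg.neg = μ)
    (hnull : ∀ m, 0 < m →
      Measure.infinitePi (fun _ : ℕ => μ) {x | ∑ i ∈ range m, x i = 0} = 0) (n : ℕ) :
    ∑ q ∈ antidiagonal n, Measure.infinitePi (fun _ : ℕ => μ) (nonnegWalks q.1) *
      Measure.infinitePi (fun _ : ℕ => μ) (nonnegWalks q.2) = 1 := by
  let A : ℕ → Set (ℕ → ℝ) := fun k => {x | ∀ j < k, 0 < ∑ i ∈ Ico j k, x i}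
  let B : ℕ × ℕ → Set (ℕ → ℝ) := fun q => {x | ∀ j ≤ q.2, ∑ i ∈ range j, x (q.1 + i) ≤ 0}
  have hA (k) : MeasurableSet (A k) := by
    simp only [A, measurableSet_setOfPred]
    fun_prop
  have hB (q) : MeasurableSet (B q) := by
    simp only [B, measurableSet_setOfPred]
    fun_prop
  have hAB (q : ℕ × ℕ) : Measure.infinitePi (fun _ : ℕ => μ) (A q.1 ∩ B q) =
      Measure.infinitePi (fun _ : ℕ => μ) (nonnegWalks q.1) *
        Measure.infinitePi (fun _ : ℕ => μ) (nonnegWalks q.2) := by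
    rw [infinitePi_inter_eq_mul_of_dependsOn (S := range q.1) (T := Ico q.1 (q.1 + q.2)) _
      (hA _) (hB _), infinitePi_pos_partial_sums hnull, infinitePi_nonpos_partial_sums_shift hμ]
    · intro x y h
      refine propext (forall₂_congr fun j hj => ?_)
      rw [sum_congr rfl fun i hi => h i (by simp at hi ⊢; omega)]
    · intro x y h
      refine propext (forall₂_congr fun j hj => ?_)
      rw [sum_congr rfl fun i hi => h (q.1 + i) (by simp at hi ⊢; omega)]
    · rw [Finset.disjoint_left]
      intro i
      simp
      omega
  rw [← sum_congr rfl fun q _ => hAB q, ← measure_biUnion_finset,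
    ← measure_univ (μ := Measure.infinitePi fun _ : ℕ => μ)]
  · congr 1
    refine Set.eq_univ_of_forall fun x => ?_
    let P : ℕ → Prop := fun k => k ≤ n ∧ ∀ j ≤ n, ∑ i ∈ range j, x i ≤ ∑ i ∈ range k, x i
    have hex : ∃ k, P k := by
      obtain ⟨k, hk, hmax⟩ :=
        exists_max_image (range (n + 1)) (fun j => ∑ i ∈ range j, x i) ⟨0, by simp⟩
      exact ⟨k, by simpa [Nat.lt_succ_iff] using hk,
        fun j hj => hmax j (by simpa [Nat.lt_succ_iff] using hj)⟩
    classical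
    obtain ⟨hkn, hmax⟩ := Nat.find_spec hex
    have hmin := fun j => Nat.find_min (H := hex) (m := j)
    set k := Nat.find hex
    simp only [Set.mem_iUnion]
    refine ⟨(k, n - k), by simp; omega, fun j hj => ?_, fun j hj => ?_⟩
    · rw [sum_Ico_eq_sub _ hj.le, sub_pos]
      by_contra! hle
      exact hmin j hj ⟨by omega, fun i hi => (hmax i hi).trans hle⟩
    · have := hmax (k + j) (by simp at hj; omega)
      rw [sum_range_add] at this
      simpa using this
  · intro q hq r hr hqr
    have key : ∀ q ∈ antidiagonal n, ∀ r ∈ antidiagonal n, q.1 < r.1 →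
        Disjoint (A q.1 ∩ B q) (A r.1 ∩ B r) := by
      intro q hq r hr h
      rw [Set.disjoint_left]
      rintro x ⟨-, hx⟩ ⟨hx', -⟩
      rw [HasAntidiagonal.mem_antidiagonal] at hq hr
      have h1 := hx (r.1 - q.1) (by omega)
      have h2 := hx' q.1 h
      rw [sum_Ico_eq_sum_range] at h2
      linarith
    rw [mem_coe] at hq hr
    rcases lt_trichotomy q.1 r.1 with h | h | h
    · exact key q hq r hr h
    · refine absurd (Prod.ext h ?_) hqr
      rw [HasAntidiagonal.mem_antidiagonal] at hq hr
      omega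
    · exact (key r hr q hq h).symm
  · exact fun q _ => (hA _).inter (hB _)

/-- **Sparre Andersen**: a symmetric random walk without ties stays nonnegative for `n` steps with
probability `centralBinom n / 4 ^ n`. -/
theorem infinitePi_nonnegWalks (hμ : μ.map Neg.neg = μ)
    (hnull : ∀ m, 0 < m →
      Measure.infinitePi (fun _ : ℕ => μ) {x | ∑ i ∈ range m, x i = 0} = 0) (n : ℕ) :
    Measure.infinitePi (fun _ : ℕ => μ) (nonnegWalks n) =
      ENNReal.ofReal (n.centralBinom / 4 ^ n) := by
  rw [← eq_centralBinom_div_of_sum_antidiagonal_eq_one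
    (p := fun n => (Measure.infinitePi (fun _ : ℕ => μ) (nonnegWalks n)).toReal)
    ENNReal.toReal_nonneg, ENNReal.ofReal_toReal (measure_ne_top _ _)]
  intro n
  have h := congrArg ENNReal.toReal (sum_antidiagonal_infinitePi_nonnegWalks hμ hnull n)
  rw [ENNReal.toReal_sum fun q _ => ENNReal.mul_ne_top (measure_ne_top _ _) (measure_ne_top _ _)]
    at h
  simpa only [ENNReal.toReal_mul, ENNReal.toReal_one] using h

end SparreAndersen

/-- The standard Laplace distribution. -/
noncomputable def laplace : Measure ℝ :=
  volume.withDensity fun x => ENNReal.ofReal (Real.exp (-|x|) / 2)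

lemma integral_exp_neg_abs_div_two : ∫ x : ℝ, Real.exp (-|x|) / 2 = 1 := by
  rw [integral_div, integral_comp_abs (f := fun x => Real.exp (-x)), integral_exp_neg_Ioi_zero]
  norm_num

lemma integrable_exp_neg_abs_div_two : Integrable fun x : ℝ => Real.exp (-|x|) / 2 :=
  .of_integral_ne_zero (by simp [integral_exp_neg_abs_div_two])

instance isProbabilityMeasure_laplace : IsProbabilityMeasure laplace where
  measure_univ := by
    rw [laplace, withDensity_apply _ .univ, Measure.restrict_univ,
      ← ofReal_integral_eq_lintegral_ofReal integrable_exp_neg_abs_div_two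
        (ae_of_all _ fun x => by positivity), integral_exp_neg_abs_div_two, ENNReal.ofReal_one]

lemma map_neg_laplace : laplace.map Neg.neg = laplace := by
  ext s hs
  rw [Measure.map_apply measurable_neg hs, laplace, withDensity_apply _ hs,
    withDensity_apply _ (measurable_neg hs),
    ← (Measure.measurePreserving_neg (volume : Measure ℝ)).setLIntegral_comp_preimage hs
      (by fun_prop)]
  simp

lemma pi_laplace (n : ℕ) : Measure.pi (fun _ : Fin n => laplace) =
    volume.withDensity fun x => ENNReal.ofReal (Real.exp (-∑ i, |x i|) / 2 ^ n) := by
  refine Measure.pi_eq fun s hs => ?_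
  have hprod (x : Fin n → ℝ) :
      Real.exp (-∑ i, |x i|) / 2 ^ n = ∏ i, Real.exp (-|x i|) / 2 := by
    rw [prod_div_distrib, ← Real.exp_sum, sum_neg_distrib]
    simp
  have hint (i) : Integrable (fun x : ℝ => Real.exp (-|x|) / 2) (volume.restrict (s i)) :=
    integrable_exp_neg_abs_div_two.integrableOn
  simp only [hprod, laplace]
  rw [withDensity_apply _ (MeasurableSet.univ_pi hs), volume_pi, Measure.restrict_pi_pi,
    ← ofReal_integral_eq_lintegral_ofReal (.fintype_prod hint)
      (ae_of_all _ fun x => by positivity),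
    integral_fintype_prod_eq_prod (fun _ (x : ℝ) => Real.exp (-|x|) / 2),
    ENNReal.ofReal_prod_of_nonneg fun i _ => integral_nonneg fun x => by positivity]
  refine prod_congr rfl fun i _ => ?_
  rw [withDensity_apply _ (hs i), ofReal_integral_eq_lintegral_ofReal (hint i)
    (ae_of_all _ fun x => by positivity)]

lemma infinitePi_laplace_sum_eq_zero (m : ℕ) (hm : 0 < m) :
    Measure.infinitePi (fun _ : ℕ => laplace) {x | ∑ i ∈ range m, x i = 0} = 0 := by
  let L : (Fin m → ℝ) →ₗ[ℝ] ℝ := ∑ i, LinearMap.proj i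
  have hL (y : Fin m → ℝ) : L y = ∑ i, y i := by simp [L]
  have hnull : Measure.pi (fun _ : Fin m => laplace) (LinearMap.ker L : Set (Fin m → ℝ)) = 0 := by
    rw [pi_laplace]
    refine withDensity_absolutelyContinuous _ _ (Measure.addHaar_submodule _ _ fun h => ?_)
    have h1 : (fun _ => 1 : Fin m → ℝ) ∈ LinearMap.ker L := h ▸ Submodule.mem_top
    rw [LinearMap.mem_ker, hL] at h1
    simp at h1
    omega
  have hpre : {x : ℕ → ℝ | ∑ i ∈ range m, x i = 0} =
      (fun x (i : Fin m) => x i) ⁻¹' (LinearMap.ker L : Set (Fin m → ℝ)) := by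
    ext x
    simp [hL, Finset.sum_range]
  rw [hpre, ← Measure.map_apply (by fun_prop)
      (Submodule.closed_of_finiteDimensional _).measurableSet,
    Measure.map_infinitePi_infinitePi_of_inj Fin.val_injective, Measure.infinitePi_eq_pi, hnull]

lemma lintegral_exp_neg_mul_pow (n : ℕ) :
    ∫⁻ t in Set.Ioi (0 : ℝ), ENNReal.ofReal (Real.exp (-t)) * ENNReal.ofReal (t ^ n) =
      (n.factorial : ENNReal) := by
  have hpos : (0 : ℝ) < n + 1 := by positivity
  have h := Real.Gamma_eq_integral hpos
  have hint := Real.GammaIntegral_convergent hpos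
  rw [Real.Gamma_nat_eq_factorial] at h
  simp only [add_sub_cancel_right, Real.rpow_natCast] at h hint
  rw [← ENNReal.ofReal_natCast, h, ofReal_integral_eq_lintegral_ofReal hint]
  · simp only [ENNReal.ofReal_mul (Real.exp_nonneg _)]
  · filter_upwards [ae_restrict_mem measurableSet_Ioi] with t ht
    have : 0 < t := ht
    positivity

/-- The Laplace measure of a cone in terms of the volume of its intersection with a cross
polytope. -/
lemma pi_laplace_cone {n : ℕ} {C : Set (Fin n → ℝ)} (hC : MeasurableSet C)
    (hsmul : ∀ t : ℝ, 0 < t → ∀ x, t • x ∈ C ↔ x ∈ C) :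
    Measure.pi (fun _ : Fin n => laplace) C =
      (n.factorial : ENNReal) * ENNReal.ofReal (1 / 4 ^ n) *
        volume (C ∩ {x | ∑ i, |x i| ≤ 2}) := by
  have hlayer (a : ℝ) : ENNReal.ofReal (Real.exp (-a)) =
      ∫⁻ t : ℝ, if a ≤ t then ENNReal.ofReal (Real.exp (-t)) else 0 := by
    have h : (fun t : ℝ => if a ≤ t then ENNReal.ofReal (Real.exp (-t)) else 0) =
        (Set.Ici a).indicator fun t => ENNReal.ofReal (Real.exp (-t)) := by
      ext t
      simp [Set.indicator]
    rw [h, lintegral_indicator measurableSet_Ici, setLIntegral_congr Ioi_ae_eq_Ici.symm,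
      ← ofReal_integral_eq_lintegral_ofReal, integral_exp_neg_Ioi]
    · exact .of_integral_ne_zero (by rw [integral_exp_neg_Ioi]; positivity)
    · exact ae_of_all _ fun t => by positivity
  have hscale (t : ℝ) (ht : 0 < t) : volume (C ∩ {x | ∑ i, |x i| ≤ t}) =
      ENNReal.ofReal (t ^ n) * (ENNReal.ofReal (1 / 2 ^ n) *
        volume (C ∩ {x | ∑ i, |x i| ≤ 2})) := by
    have hset : C ∩ {x | ∑ i, |x i| ≤ t} = (t / 2) • (C ∩ {x | ∑ i, |x i| ≤ 2}) := by
      ext x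
      rw [Set.mem_smul_set_iff_inv_smul_mem₀ (by positivity)]
      simp only [Set.mem_inter_iff, Set.mem_ofPred_eq, hsmul _ (inv_pos.mpr (half_pos ht)),
        Pi.smul_apply, smul_eq_mul, abs_mul, ← mul_sum]
      rw [abs_of_pos (inv_pos.mpr (half_pos ht)), inv_mul_le_iff₀ (half_pos ht)]
      simp
    rw [hset, Measure.addHaar_smul_of_nonneg _ (by positivity), ← mul_assoc,
      ← ENNReal.ofReal_mul (by positivity)]
    simp only [Module.finrank_fintype_fun_eq_card, Fintype.card_fin, div_pow, mul_one_div]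
  have hswap : ∫⁻ x in C, ENNReal.ofReal (Real.exp (-∑ i, |x i|)) =
      ∫⁻ t : ℝ, ENNReal.ofReal (Real.exp (-t)) * volume (C ∩ {x | ∑ i, |x i| ≤ t}) := by
    rw [lintegral_congr fun x => hlayer _, lintegral_lintegral_swap]
    · refine lintegral_congr fun t => ?_
      have hm : MeasurableSet {x : Fin n → ℝ | ∑ i, |x i| ≤ t} :=
        measurableSet_le (by fun_prop) (by fun_prop)
      rw [Set.inter_comm, ← Measure.restrict_apply hm, ← lintegral_indicator_const hm]
      exact lintegral_congr fun x => by simp [Set.indicator]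
    · refine (Measurable.ite (measurableSet_le ?_ ?_) ?_ measurable_const).aemeasurable <;> fun_prop
  have hpos : ∫⁻ t : ℝ, ENNReal.ofReal (Real.exp (-t)) * volume (C ∩ {x | ∑ i, |x i| ≤ t}) =
      ∫⁻ t in Set.Ioi (0 : ℝ),
        ENNReal.ofReal (Real.exp (-t)) * volume (C ∩ {x | ∑ i, |x i| ≤ t}) := by
    rw [setLIntegral_congr Ioi_ae_eq_Ici]
    refine (setLIntegral_eq_of_support_subset fun t ht => ?_).symm
    rw [Set.mem_Ici]
    by_contra! h
    refine ht ?_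
    have : {x : Fin n → ℝ | ∑ i, |x i| ≤ t} = ∅ := by
      ext x
      have : 0 ≤ ∑ i, |x i| := sum_nonneg fun i _ => abs_nonneg _
      simpa using h.trans_le this
    simp [this]
  rw [pi_laplace, withDensity_apply _ hC]
  simp only [div_eq_mul_inv, ENNReal.ofReal_mul (Real.exp_nonneg _)]
  rw [lintegral_mul_const _ (by fun_prop), hswap, hpos,
    setLIntegral_congr_fun measurableSet_Ioi fun t ht => by rw [hscale t ht, ← mul_assoc],
    lintegral_mul_const _ (by fun_prop), lintegral_exp_neg_mul_pow, mul_assoc, mul_assoc,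
    mul_assoc]
  have h4 : ENNReal.ofReal (1 * (4 ^ n)⁻¹) =
      ENNReal.ofReal (1 / 2 ^ n) * ENNReal.ofReal ((2 ^ n)⁻¹) := by
    rw [← ENNReal.ofReal_mul (by positivity), one_div, ← mul_inv, ← mul_pow, one_mul]
    norm_num
  rw [h4]
  ring

/-- The vectors all of whose partial sums are nonnegative. This is the cone spanned by the positive
roots of type `C`. -/
def partialSumCone (n : ℕ) : Set (Fin n → ℝ) := {x | ∀ j, 0 ≤ ∑ i ∈ Iic j, x i}

lemma partialSumCone_smul_mem_iff {n : ℕ} (t : ℝ) (ht : 0 < t) (x : Fin n → ℝ) :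
    t • x ∈ partialSumCone n ↔ x ∈ partialSumCone n := by
  simp [partialSumCone, ← mul_sum, ht]

lemma convex_partialSumCone (n : ℕ) : Convex ℝ (partialSumCone n) := by
  intro x hx y hy a b ha hb _ j
  simp only [Pi.add_apply, Pi.smul_apply, smul_eq_mul, sum_add_distrib, ← mul_sum]
  exact add_nonneg (mul_nonneg ha (hx j)) (mul_nonneg hb (hy j))

lemma convex_sum_abs_le (n : ℕ) (c : ℝ) : Convex ℝ {x : Fin n → ℝ | ∑ i, |x i| ≤ c} := by
  intro x hx y hy a b ha hb hab
  calc ∑ i, |a * x i + b * y i| ≤ ∑ i, (a * |x i| + b * |y i|) := by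
        refine sum_le_sum fun i _ => (abs_add_le _ _).trans_eq ?_
        rw [abs_mul, abs_mul, abs_of_nonneg ha, abs_of_nonneg hb]
    _ = a * ∑ i, |x i| + b * ∑ i, |y i| := by rw [sum_add_distrib, mul_sum, mul_sum]
    _ ≤ a * c + b * c := by
        gcongr
        · exact hx
        · exact hy
    _ = c := by rw [← add_mul, hab, one_mul]

lemma single_mem_partialSumCone {n : ℕ} (i : Fin n) : Pi.single i (1 : ℝ) ∈ partialSumCone n :=
  fun j => sum_nonneg fun k _ => by rw [Pi.single_apply]; split_ifs <;> norm_num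

lemma single_sub_single_mem_partialSumCone {n : ℕ} {i j : Fin n} (hij : i < j) :
    Pi.single i (1 : ℝ) - Pi.single j 1 ∈ partialSumCone n := by
  intro k
  simp only [Pi.sub_apply, sum_sub_distrib, Pi.single_apply, sum_ite_eq', mem_Iic]
  split_ifs with hi hj hj
  · norm_num
  · norm_num
  · exact absurd (hij.le.trans hj) hi
  · norm_num

lemma sum_abs_single_add_le {n : ℕ} (i j : Fin n) (s : ℝ) (hs : |s| = 1) :
    ∑ k, |(Pi.single i 1 + s • Pi.single j 1 : Fin n → ℝ) k| ≤ 2 := by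
  calc ∑ k, |(Pi.single i 1 + s • Pi.single j 1 : Fin n → ℝ) k|
      ≤ ∑ k, ((Pi.single i 1 : Fin n → ℝ) k + (Pi.single j 1 : Fin n → ℝ) k) := by
        refine sum_le_sum fun k _ => (abs_add_le _ _).trans_eq ?_
        rw [Pi.smul_apply, smul_eq_mul, abs_mul, hs, one_mul, Pi.single_apply, Pi.single_apply]
        split_ifs <;> simp
    _ = 2 := by
        simp [sum_add_distrib]
        norm_num

/-- A vector with nonnegative partial sums and a negative entry can be shortened by a multiple of
some `e i - e j` with `i < j`, keeping its partial sums nonnegative and cancelling an entry. -/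
lemma exists_sub_smul_root_mem {n : ℕ} {x : Fin n → ℝ} (hx : x ∈ partialSumCone n)
    (hneg : ∃ j, x j < 0) :
    ∃ i j : Fin n, i < j ∧ ∃ t : ℝ, 0 ≤ t ∧
      ∃ y ∈ partialSumCone n, y + t • (Pi.single i 1 - Pi.single j 1) = x ∧
        ∑ k, |y k| = ∑ k, |x k| - 2 * t ∧ #{k | y k ≠ 0} < #{k | x k ≠ 0} := by
  obtain ⟨j, hj, hmin⟩ := WellFounded.has_min (wellFounded_lt (α := Fin n)) {j | x j < 0} hneg
  have hnonneg (k : Fin n) (hk : k < j) : 0 ≤ x k := not_lt.mp fun h => hmin k h hk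
  obtain ⟨i, hij, hi⟩ : ∃ i < j, 0 < x i := by
    by_contra! h
    refine (hx j).not_gt ?_
    rw [← Iio_insert, sum_insert (by simp)]
    have := sum_nonpos fun k (hk : k ∈ Iio j) => h k (mem_Iio.mp hk)
    have : x j < 0 := hj
    linarith
  have hj' : x j < 0 := hj
  set t := min (x i) (-x j) with ht
  have hti : t ≤ x i := min_le_left _ _
  have htj : t ≤ -x j := min_le_right _ _
  have ht0 : 0 < t := lt_min hi (by linarith)
  set y := x - t • (Pi.single i 1 - Pi.single j 1 : Fin n → ℝ) with hy
  have hyi : y i = x i - t := by simp [hy, hij.ne]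
  have hyj : y j = x j + t := by simp [hy, hij.ne']
  have hyk (k) (h1 : k ≠ i) (h2 : k ≠ j) : y k = x k := by simp [hy, h1, h2]
  refine ⟨i, j, hij, t, ht0.le, y, fun k => ?_, sub_add_cancel _ _, ?_, ?_⟩
  · rcases lt_or_ge k j with hk | hk
    · refine sum_nonneg fun l hl => ?_
      have hlj : l < j := (mem_Iic.mp hl).trans_lt hk
      rcases eq_or_ne l i with rfl | hli
      · rw [hyi]; linarith
      · rw [hyk l hli hlj.ne]; exact hnonneg l hlj
    · have : ∑ l ∈ Iic k, y l = ∑ l ∈ Iic k, x l := by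
        simp [hy, sum_sub_distrib, ← mul_sum, hk, hij.le.trans hk]
      rw [this]
      exact hx k
  · have habs (k) : |y k| = |x k| - (t * (Pi.single i 1 : Fin n → ℝ) k +
        t * (Pi.single j 1 : Fin n → ℝ) k) := by
      rcases eq_or_ne k i with rfl | h1
      · rw [hyi, abs_of_nonneg (by linarith), abs_of_pos hi]
        simp [hij.ne]
      · rcases eq_or_ne k j with rfl | h2
        · rw [hyj, abs_of_nonpos (by linarith), abs_of_neg hj']
          simp [hij.ne']
          ring
        · simp [hyk k h1 h2, h1, h2]
    simp only [habs, sum_sub_distrib, sum_add_distrib, ← mul_sum]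
    simp
    ring
  · refine card_lt_card (ssubset_iff_of_subset ?_ |>.mpr ?_)
    · intro k
      simp only [mem_filter, mem_univ, true_and]
      rcases eq_or_ne k i with rfl | h1
      · exact fun _ => hi.ne'
      · rcases eq_or_ne k j with rfl | h2
        · exact fun _ => hj'.ne
        · rw [hyk k h1 h2]; exact id
    · rcases min_choice (x i) (-x j) with h | h
      · exact ⟨i, by simp [hi.ne'], by simp [hyi, ht, h]⟩
      · exact ⟨j, by simp [hj'.ne], by simp [hyj, ht, h]⟩

/-- A vector with nonnegative partial sums and `ℓ¹` norm at most `2 * c` lies in `c • K`, for every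
convex `K` containing `0`, the roots `e i - e j` with `i < j` and the roots `2 e i`. -/
lemma mem_smul_of_mem_partialSumCone {n : ℕ} {K : Set (Fin n → ℝ)} (hK : Convex ℝ K)
    (h0 : 0 ∈ K) (hsub : ∀ i j, i < j → Pi.single i 1 - Pi.single j 1 ∈ K)
    (htwo : ∀ i, (2 : ℝ) • Pi.single i 1 ∈ K) (x : Fin n → ℝ) (hx : x ∈ partialSumCone n)
    (c : ℝ) (hc : ∑ i, |x i| ≤ 2 * c) : x ∈ c • K := by
  induction hs : #{k | x k ≠ 0} using Nat.strong_induction_on generalizing x c with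
  | _ s ih =>
    by_cases hneg : ∃ j, x j < 0
    · obtain ⟨i, j, hij, t, ht, y, hmem, hyx, habs, hcard⟩ := exists_sub_smul_root_mem hx hneg
      have hct : 0 ≤ c - t := by
        have : 0 ≤ ∑ k, |y k| := sum_nonneg fun _ _ => abs_nonneg _
        linarith
      have := ih _ (hs ▸ hcard) _ hmem (c - t) (by linarith) rfl
      rw [← sub_add_cancel c t, hK.add_smul hct ht]
      exact ⟨_, this, _, Set.smul_mem_smul_set (hsub i j hij), hyx⟩
    · push Not at hneg
      simp only [abs_of_nonneg (hneg _)] at hc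
      rcases (sum_nonneg fun i _ => hneg i).eq_or_lt' with hzero | hpos
      · have hx0 : x = 0 := funext fun i =>
          (sum_eq_zero_iff_of_nonneg fun i _ => hneg i).mp hzero i (mem_univ i)
        exact ⟨0, h0, by simp [hx0]⟩
      have hcpos : 0 < c := by linarith
      rw [Set.mem_smul_set_iff_inv_smul_mem₀ hcpos.ne']
      have hcenter := hK.sum_mem (t := univ) (w := fun i => x i / ∑ i, x i)
        (fun i _ => div_nonneg (hneg i) hpos.le) (by rw [← sum_div, div_self hpos.ne'])
        fun i _ => htwo i
      have hxeq : c⁻¹ • x = ((∑ i, x i) / (2 * c)) •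
          ∑ i, (x i / ∑ i, x i) • (2 : ℝ) • (Pi.single i 1 : Fin n → ℝ) := by
        ext k
        simp only [Pi.smul_apply, Finset.sum_apply, smul_eq_mul, Pi.single_apply, mul_ite, mul_one,
          mul_zero, sum_ite_eq, mem_univ, if_true]
        field_simp
      rw [hxeq]
      exact hK.smul_mem_of_zero_mem h0 hcenter
        ⟨by positivity, (div_le_one (by positivity)).mpr hc⟩

/-- The type `C` positive root polytope is the intersection of the cone of positive roots with a
cross polytope. -/
lemma convexHull_positive_roots {n : ℕ} :
    convexHull ℝ ({v : Fin n → ℝ | (∃ i j : Fin n, i < j ∧ v = Pi.single i 1 - Pi.single j 1) ∨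
      (∃ i j : Fin n, i ≤ j ∧ v = Pi.single i 1 + Pi.single j 1)} ∪ {0}) =
      partialSumCone n ∩ {x | ∑ i, |x i| ≤ 2} := by
  refine (convexHull_min ?_ ((convex_partialSumCone n).inter (convex_sum_abs_le n 2))).antisymm ?_
  · rintro v ((⟨i, j, hij, rfl⟩ | ⟨i, j, -, rfl⟩) | rfl)
    · refine ⟨single_sub_single_mem_partialSumCone hij, ?_⟩
      simpa [sub_eq_add_neg] using sum_abs_single_add_le i j (-1) (by simp)
    · refine ⟨fun k => ?_, ?_⟩
      · simp only [Pi.add_apply, sum_add_distrib]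
        exact add_nonneg (single_mem_partialSumCone i k) (single_mem_partialSumCone j k)
      · simpa using sum_abs_single_add_le i j 1 (by simp)
    · simp [partialSumCone]
  · rintro x ⟨hx, hx2⟩
    rw [← one_smul ℝ (convexHull ℝ _)]
    refine mem_smul_of_mem_partialSumCone (convex_convexHull ℝ _) (subset_convexHull ℝ _ (by simp))
      (fun i j hij => subset_convexHull ℝ _ (.inl (.inl ⟨i, j, hij, rfl⟩)))
      (fun i => subset_convexHull ℝ _ (.inl (.inr ⟨i, i, le_rfl, two_smul ℝ _⟩))) x hx 1 ?_
    simpa using hx2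

lemma measurableSet_partialSumCone (n : ℕ) : MeasurableSet (partialSumCone n) := by
  simp only [partialSumCone, measurableSet_setOfPred]
  fun_prop

lemma preimage_partialSumCone (n : ℕ) :
    (fun (x : ℕ → ℝ) (i : Fin n) => x i) ⁻¹' partialSumCone n = nonnegWalks n := by
  have hsum (x : ℕ → ℝ) (j : Fin n) : ∑ i ∈ Iic j, x i = ∑ i ∈ range (j + 1), x i := by
    rw [Nat.range_succ_eq_Iic, ← Fin.map_valEmbedding_Iic, sum_map]
    rfl
  ext x
  refine ⟨fun h m hm => ?_, fun h j => ?_⟩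
  · cases m with
    | zero => simp
    | succ m => exact (h ⟨m, hm⟩).trans_eq (hsum x ⟨m, hm⟩)
  · exact (h (j + 1) j.isLt).trans_eq (hsum x j).symm

lemma pi_laplace_partialSumCone (n : ℕ) :
    Measure.pi (fun _ : Fin n => laplace) (partialSumCone n) =
      ENNReal.ofReal (n.centralBinom / 4 ^ n) := by
  rw [← infinitePi_nonnegWalks map_neg_laplace infinitePi_laplace_sum_eq_zero,
    ← preimage_partialSumCone,
    ← Measure.map_apply (by fun_prop) (measurableSet_partialSumCone n),
    Measure.map_infinitePi_infinitePi_of_inj Fin.val_injective, Measure.infinitePi_eq_pi]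

lemma volume_partialSumCone_inter (n : ℕ) :
    volume (partialSumCone n ∩ {x | ∑ i, |x i| ≤ 2}) =
      (n.centralBinom : ENNReal) / (n.factorial : ENNReal) := by
  have h := pi_laplace_cone (measurableSet_partialSumCone n) partialSumCone_smul_mem_iff
  have h4 : ENNReal.ofReal (1 / 4 ^ n) ≠ 0 := by
    rw [Ne, ENNReal.ofReal_eq_zero, not_le]
    positivity
  rw [pi_laplace_partialSumCone, div_eq_mul_one_div, ENNReal.ofReal_mul (by positivity),
    ENNReal.ofReal_natCast, mul_comm, mul_comm (n.factorial : ENNReal), mul_assoc,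
    ENNReal.mul_right_inj h4 ENNReal.ofReal_ne_top, mul_comm] at h
  rw [h, ENNReal.mul_div_cancel_right (by simpa using n.factorial_ne_zero)
    (ENNReal.natCast_ne_top _)]

/-- Type C_n: the Lebesgue volume of the positive root polytope conv(Φ⁺ ∪ {0}) is
C(2n,n)/n!. -/
theorem typeC_positive_root_polytope_volume (n : ℕ) (hn : 1 ≤ n)
    (e : Fin n → (Fin n → ℝ))
    (he : ∀ i, e i = fun k => if k = i then (1 : ℝ) else 0)
    (Φpos : Set (Fin n → ℝ))
    (hΦpos : Φpos = {v | (∃ i j : Fin n, i < j ∧ v = e i - e j) ∨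
        (∃ i j : Fin n, i ≤ j ∧ v = e i + e j)}) :
    MeasureTheory.volume (convexHull ℝ (Φpos ∪ {0}))
      = (Nat.choose (2 * n) n : ENNReal) / (Nat.factorial n : ENNReal) := by
  have he' : e = fun i => Pi.single i 1 := by
    ext i k
    rw [he, Pi.single_apply]
  rw [hΦpos, he', convexHull_positive_roots, volume_partialSumCone_inter,
    Nat.centralBinom_eq_two_mul_choose]
end

section
/- Let n ≥ 1 and realize the type A_n root system in simple-root coordinates in ℝ^n, i.e. Φ′ = {±v_{i,j} : 1 ≤ i ≤ j ≤ n} where v_{i,j} = e_i + e_{i+1} + ⋯ + e_j. The Lebesgue volume of the root polytope conv(Φ′) is C(2n, n)/n!. (Equivalently, vol(𝒫_{A_n})/vol(conv({0} ∪ Π)) = C(2n,n), since the fundamental simplex on the simple roots has volume 1/n! in these coordinates.) -/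
open MeasureTheory Finset

/-- The points of `ℝⁿ` whose positive parts sum to at most `a` and whose negative parts sum to at
most `b`. -/
def signedSimplex (n : ℕ) (a b : ℝ) : Set (Fin n → ℝ) :=
  {y | ∑ i, max (y i) 0 ≤ a ∧ ∑ i, max (-y i) 0 ≤ b}

/-- The volume of `signedSimplex n a b` for `0 ≤ a` and `0 ≤ b`. -/
noncomputable def signedSimplexVolume (n : ℕ) (a b : ℝ) : ℝ :=
  ∑ p ∈ antidiagonal n,
    (n.choose p.1 : ℝ) * (a ^ p.1 / Nat.factorial p.1 * (b ^ p.2 / Nat.factorial p.2))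

lemma measurableSet_signedSimplex (n : ℕ) (a b : ℝ) : MeasurableSet (signedSimplex n a b) := by
  have h1 : Measurable fun y : Fin n → ℝ => ∑ i, max (y i) 0 := by fun_prop
  have h2 : Measurable fun y : Fin n → ℝ => ∑ i, max (-y i) 0 := by fun_prop
  exact (measurableSet_le h1 measurable_const).inter (measurableSet_le h2 measurable_const)

lemma continuous_signedSimplexVolume {f g : ℝ → ℝ} (n : ℕ) (hf : Continuous f)
    (hg : Continuous g) : Continuous fun t => signedSimplexVolume n (f t) (g t) := by
  unfold signedSimplexVolume
  fun_prop

lemma signedSimplexVolume_nonneg (n : ℕ) {a b : ℝ} (ha : 0 ≤ a) (hb : 0 ≤ b) :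
    0 ≤ signedSimplexVolume n a b := by
  unfold signedSimplexVolume
  positivity

lemma integral_sub_pow_div_factorial (a : ℝ) (k : ℕ) :
    ∫ t in (0 : ℝ)..a, (a - t) ^ k / k.factorial = a ^ (k + 1) / (k + 1).factorial := by
  rw [intervalIntegral.integral_comp_sub_left (fun t => t ^ k / (k.factorial : ℝ)) a]
  simp only [sub_self, sub_zero, intervalIntegral.integral_div, integral_pow]
  rw [Nat.factorial_succ]
  push_cast
  field_simp
  simp

lemma integral_add_pow_div_factorial (b : ℝ) (k : ℕ) :
    ∫ t in (-b)..0, (b + t) ^ k / k.factorial = b ^ (k + 1) / (k + 1).factorial := by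
  rw [intervalIntegral.integral_comp_add_left (fun t => t ^ k / (k.factorial : ℝ)) b]
  simp only [add_neg_cancel, add_zero, intervalIntegral.integral_div, integral_pow]
  rw [Nat.factorial_succ]
  push_cast
  field_simp
  simp

lemma signedSimplexVolume_succ (n : ℕ) (a b : ℝ) :
    signedSimplexVolume (n + 1) a b = (∫ t in (-b)..0, signedSimplexVolume n a (b + t)) +
      ∫ t in (0 : ℝ)..a, signedSimplexVolume n (a - t) b := by
  unfold signedSimplexVolume
  rw [sum_antidiagonal_choose_succ_mul
    (fun i j => a ^ i / i.factorial * (b ^ j / j.factorial))]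
  rw [intervalIntegral.integral_finsetSum
      (fun i _ => Continuous.intervalIntegrable (by fun_prop) _ _),
    intervalIntegral.integral_finsetSum
      (fun i _ => Continuous.intervalIntegrable (by fun_prop) _ _)]
  congr 1
  · refine sum_congr rfl fun p _ => ?_
    rw [intervalIntegral.integral_const_mul, intervalIntegral.integral_const_mul,
      integral_add_pow_div_factorial]
  · refine sum_congr rfl fun p hp => ?_
    rw [intervalIntegral.integral_const_mul, intervalIntegral.integral_mul_const,
      integral_sub_pow_div_factorial, ← Nat.choose_symm_of_eq_add (mem_antidiagonal.mp hp).symm]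

lemma signedSimplex_eq_empty_of_neg (n : ℕ) {a b : ℝ} (h : a < 0 ∨ b < 0) :
    signedSimplex n a b = ∅ := by
  refine Set.eq_empty_of_forall_notMem fun y hy => ?_
  have h1 : 0 ≤ ∑ i, max (y i) 0 := sum_nonneg fun i _ => le_max_right _ _
  have h2 : 0 ≤ ∑ i, max (-y i) 0 := sum_nonneg fun i _ => le_max_right _ _
  rcases h with h | h
  · linarith [hy.1]
  · linarith [hy.2]

lemma volume_signedSimplex_succ (n : ℕ) (a b : ℝ) :
    volume (signedSimplex (n + 1) a b) =
      ∫⁻ t, volume (signedSimplex n (a - max t 0) (b - max (-t) 0)) := by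
  have hp := volume_preserving_piFinSuccAbove (fun _ : Fin (n + 1) => ℝ) 0
  rw [← (hp.symm _).measure_preimage (measurableSet_signedSimplex _ _ _).nullMeasurableSet,
    Measure.volume_eq_prod, Measure.prod_apply]
  · refine lintegral_congr fun t => congrArg _ ?_
    ext y
    simp [signedSimplex, Fin.sum_univ_succ, le_sub_iff_add_le']
  · exact (MeasurableEquiv.measurable _) (measurableSet_signedSimplex _ _ _)

lemma volume_signedSimplex (n : ℕ) {a b : ℝ} (ha : 0 ≤ a) (hb : 0 ≤ b) :
    volume (signedSimplex n a b) = ENNReal.ofReal (signedSimplexVolume n a b) := by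
  induction n generalizing a b with
  | zero =>
    have : signedSimplex 0 a b = Set.univ := by
      ext y
      simp [signedSimplex, ha, hb]
    simp [this, signedSimplexVolume, volume_pi]
  | succ n ih =>
    have hc : Continuous fun t : ℝ => signedSimplexVolume n (a - max t 0) (b - max (-t) 0) :=
      continuous_signedSimplexVolume n (by fun_prop) (by fun_prop)
    have hslice : ∀ t ∈ Set.Icc (-b) a, 0 ≤ a - max t 0 ∧ 0 ≤ b - max (-t) 0 := fun t ht =>
      ⟨sub_nonneg.2 (max_le ht.2 ha), sub_nonneg.2 (max_le (by linarith [ht.1]) hb)⟩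
    have hind : (fun t => volume (signedSimplex n (a - max t 0) (b - max (-t) 0))) =
        (Set.Icc (-b) a).indicator fun t =>
          ENNReal.ofReal (signedSimplexVolume n (a - max t 0) (b - max (-t) 0)) := by
      funext t
      by_cases ht : t ∈ Set.Icc (-b) a
      · rw [Set.indicator_of_mem ht, ih (hslice t ht).1 (hslice t ht).2]
      · rw [Set.indicator_of_notMem ht, signedSimplex_eq_empty_of_neg, measure_empty]
        rw [Set.mem_Icc, not_and_or, not_le, not_le] at ht
        rcases ht with ht | ht
        · exact Or.inr (by linarith [le_max_left (-t) 0])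
        · exact Or.inl (by linarith [le_max_left t 0])
    rw [volume_signedSimplex_succ, hind, lintegral_indicator measurableSet_Icc,
      ← ofReal_integral_eq_lintegral_ofReal hc.integrableOn_Icc
        ((ae_restrict_iff' measurableSet_Icc).2 (ae_of_all _ fun t ht =>
          signedSimplexVolume_nonneg n (hslice t ht).1 (hslice t ht).2)),
      integral_Icc_eq_integral_Ioc, ← intervalIntegral.integral_of_le (by linarith),
      ← intervalIntegral.integral_add_adjacent_intervals (b := 0)
        (hc.intervalIntegrable _ _) (hc.intervalIntegrable _ _), signedSimplexVolume_succ]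
    congr 2
    · refine intervalIntegral.integral_congr fun t ht => ?_
      rw [Set.uIcc_of_le (by linarith)] at ht
      simp [max_eq_right ht.2, max_eq_left (neg_nonneg.2 ht.2)]
    · refine intervalIntegral.integral_congr fun t ht => ?_
      rw [Set.uIcc_of_le ha] at ht
      simp [max_eq_left ht.1, max_eq_right (neg_nonpos.2 ht.1)]

lemma signedSimplexVolume_one_one (n : ℕ) :
    signedSimplexVolume n 1 1 = ((2 * n).choose n : ℝ) / n.factorial := by
  rw [two_mul, Nat.add_choose_eq, signedSimplexVolume]
  push_cast
  rw [sum_div]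
  refine sum_congr rfl fun p hp => ?_
  obtain ⟨i, j⟩ := p
  obtain rfl : i + j = n := mem_antidiagonal.mp hp
  have h : ((i + j).choose i : ℝ) * i.factorial * j.factorial = (i + j).factorial := by
    rw [Nat.choose_symm_add]
    exact_mod_cast Nat.add_choose_mul_factorial_mul_factorial i j
  have h' : (i + j).choose j = (i + j).choose i := Nat.choose_symm_add.symm
  simp only [h', ← h, one_pow]
  have : ((i + j).choose i : ℝ) ≠ 0 := by
    exact_mod_cast (Nat.choose_pos (Nat.le_add_right i j)).ne'
  field_simp

lemma volume_signedSimplex_one_one (n : ℕ) :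
    volume (signedSimplex n 1 1) =
      (Nat.choose (2 * n) n : ENNReal) / (Nat.factorial n : ENNReal) := by
  rw [volume_signedSimplex n zero_le_one zero_le_one, signedSimplexVolume_one_one,
    ENNReal.ofReal_div_of_pos (by positivity), ENNReal.ofReal_natCast, ENNReal.ofReal_natCast]

/-- The `m`-th standard basis vector of `ℝⁿ`, or `0` if `n ≤ m`. -/
def basisOrZero (n m : ℕ) : Fin n → ℝ := fun k => if (k : ℕ) = m then 1 else 0

lemma mem_convexHull_range_basisOrZero {n : ℕ} {y : Fin n → ℝ} (hy : ∀ i, 0 ≤ y i)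
    (hs : ∑ i, y i ≤ 1) : y ∈ convexHull ℝ (Set.range (basisOrZero n)) := by
  have h := (convex_convexHull ℝ (Set.range (basisOrZero n))).sum_mem
    (t := (univ : Finset (Fin (n + 1)))) (w := Fin.snoc (α := fun _ => ℝ) y (1 - ∑ i, y i))
    (z := fun m => basisOrZero n m) ?_ ?_ (fun m _ => subset_convexHull _ _ ⟨m, rfl⟩)
  · convert h using 1
    funext k
    have hk : (k : ℕ) ≠ n := k.2.ne
    simp [Fin.sum_univ_castSucc, basisOrZero, hk, Fin.val_inj]
  · intro i _
    refine Fin.lastCases ?_ (fun j => ?_) i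
    · simpa using hs
    · simpa using hy j
  · simp [Fin.sum_univ_castSucc]

lemma sum_max_basisOrZero_sub_le (n p q : ℕ) :
    ∑ i, max ((basisOrZero n p - basisOrZero n q) i) 0 ≤ 1 := by
  calc ∑ i, max ((basisOrZero n p - basisOrZero n q) i) 0 ≤ ∑ i, basisOrZero n p i := by
        refine sum_le_sum fun i _ => ?_
        simp only [basisOrZero, Pi.sub_apply]
        split_ifs <;> simp
    _ ≤ 1 := by
        by_cases hp : p < n
        · have : ∀ i : Fin n, basisOrZero n p i = if i = ⟨p, hp⟩ then 1 else 0 := fun i => by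
            simp [basisOrZero, Fin.ext_iff]
          simp [this]
        · have : ∀ i : Fin n, basisOrZero n p i = 0 := fun i => by
            simp only [basisOrZero, ite_eq_right_iff]
            omega
          simp [this]

lemma convexOn_sum_max_zero (n : ℕ) :
    ConvexOn ℝ Set.univ fun y : Fin n → ℝ => ∑ i, max (y i) 0 := by
  refine ⟨convex_univ, fun x _ y _ s t hs ht _ => ?_⟩
  simp only [smul_eq_mul, mul_sum, ← sum_add_distrib, Pi.add_apply, Pi.smul_apply]
  refine sum_le_sum fun i _ => max_le ?_ (by positivity)
  gcongr <;> exact le_max_left _ _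

lemma convex_signedSimplex (n : ℕ) (a b : ℝ) : Convex ℝ (signedSimplex n a b) := by
  have h1 := (convexOn_sum_max_zero n).convex_le a
  have h2 := ((convexOn_sum_max_zero n).convex_le b).neg
  simpa [signedSimplex, Set.ofPred_and] using h1.inter h2

open scoped Pointwise in
lemma signedSimplex_one_one_eq_convexHull (n : ℕ) :
    signedSimplex n 1 1 =
      convexHull ℝ {y | ∃ p q : ℕ, y = basisOrZero n p - basisOrZero n q} := by
  apply Set.Subset.antisymm
  · intro y hy
    have hset : {y | ∃ p q : ℕ, y = basisOrZero n p - basisOrZero n q} =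
        Set.range (basisOrZero n) - Set.range (basisOrZero n) := by
      ext y
      simp [Set.mem_sub, eq_comm]
    rw [hset, convexHull_sub]
    refine ⟨_, mem_convexHull_range_basisOrZero (y := fun i => max (y i) 0)
      (fun i => le_max_right _ _) hy.1, _, mem_convexHull_range_basisOrZero
      (y := fun i => max (-y i) 0) (fun i => le_max_right _ _) hy.2, ?_⟩
    funext i
    simp only [Pi.sub_apply]
    rcases le_total 0 (y i) with h | h
    · simp [max_eq_left h, max_eq_right (neg_nonpos.2 h)]
    · simp [max_eq_right h, max_eq_left (neg_nonneg.2 h)]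
  · refine convexHull_min ?_ (convex_signedSimplex n 1 1)
    rintro _ ⟨p, q, rfl⟩
    refine ⟨sum_max_basisOrZero_sub_le n p q, ?_⟩
    simpa using sum_max_basisOrZero_sub_le n q p

/-- The linear map sending a vector to its partial sums. -/
noncomputable def partialSums (n : ℕ) : (Fin n → ℝ) →ₗ[ℝ] (Fin n → ℝ) :=
  Matrix.toLin' (Matrix.of fun k i => if i ≤ k then 1 else 0)

lemma partialSums_apply (n : ℕ) (y : Fin n → ℝ) (k : Fin n) :
    partialSums n y k = ∑ i, if i ≤ k then y i else 0 := by
  simp [partialSums, Matrix.mulVec, dotProduct]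

lemma det_partialSums (n : ℕ) : LinearMap.det (partialSums n) = 1 := by
  rw [partialSums, LinearMap.det_toLin', Matrix.det_of_isLowerTriangular]
  · simp
  · intro i j hij
    simpa using hij

lemma partialSums_basisOrZero (n m : ℕ) (k : Fin n) :
    partialSums n (basisOrZero n m) k = if m ≤ k then 1 else 0 := by
  rw [partialSums_apply]
  by_cases hm : m < n
  · rw [sum_eq_single ⟨m, hm⟩]
    · simp [basisOrZero, Fin.le_def]
    · intro i _ hi
      have : (i : ℕ) ≠ m := fun h => hi (Fin.ext h)
      simp [basisOrZero, this]
    · simp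
  · rw [if_neg (by omega)]
    refine sum_eq_zero fun i _ => ?_
    have : (i : ℕ) ≠ m := by omega
    simp [basisOrZero, this]

lemma sum_Icc_indicator_eq {n : ℕ} (i j : Fin n) (hij : i ≤ j) :
    (∑ k ∈ Icc i j, fun l => if l = k then (1 : ℝ) else 0) =
      partialSums n (basisOrZero n i - basisOrZero n (j + 1)) := by
  funext l
  rw [map_sub, Pi.sub_apply, partialSums_basisOrZero, partialSums_basisOrZero, Finset.sum_apply,
    sum_ite_eq]
  simp only [mem_Icc, Fin.le_def] at hij ⊢
  split_ifs <;> first | omega | norm_num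

lemma partialSums_sub_mem_root {n p q : ℕ} (hpq : p < q) (hp : p < n) :
    ∃ i j : Fin n, i ≤ j ∧ partialSums n (basisOrZero n p - basisOrZero n q) =
      ∑ k ∈ Icc i j, fun l => if l = k then (1 : ℝ) else 0 := by
  have hij : (⟨p, hp⟩ : Fin n) ≤ ⟨min q n - 1, by omega⟩ := by
    simp only [Fin.mk_le_mk]
    omega
  refine ⟨_, _, hij, ?_⟩
  rw [sum_Icc_indicator_eq _ _ hij]
  funext l
  simp only [map_sub, Pi.sub_apply, partialSums_basisOrZero]
  have := l.2
  congr 2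
  apply propext
  omega

/-- Type A_n in simple-root coordinates: the Lebesgue volume of the root polytope is
C(2n,n)/n!. -/
theorem typeA_root_polytope_volume (n : ℕ) (hn : 1 ≤ n)
    (e : Fin n → (Fin n → ℝ))
    (he : ∀ i, e i = fun k => if k = i then (1 : ℝ) else 0)
    (Φ' : Set (Fin n → ℝ))
    (hΦ' : Φ' = {v | ∃ i j : Fin n, i ≤ j ∧
        (v = ∑ k ∈ Finset.Icc i j, e k ∨ v = -∑ k ∈ Finset.Icc i j, e k)}) :
    MeasureTheory.volume (convexHull ℝ Φ')
      = (Nat.choose (2 * n) n : ENNReal) / (Nat.factorial n : ENNReal) := by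

  obtain rfl : e = fun i k => if k = i then (1 : ℝ) else 0 := funext he
  have hneg : ∀ v ∈ Φ', -v ∈ Φ' := by
    subst hΦ'
    rintro v ⟨i, j, hij, rfl | rfl⟩
    · exact ⟨i, j, hij, Or.inr rfl⟩
    · exact ⟨i, j, hij, Or.inl (neg_neg _)⟩
  have hzero : (0 : Fin n → ℝ) ∈ convexHull ℝ Φ' := by
    have hv : ∃ v, v ∈ Φ' := by
      subst hΦ'
      exact ⟨_, ⟨0, hn⟩, ⟨0, hn⟩, le_rfl, Or.inl rfl⟩
    obtain ⟨v, hv⟩ := hv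
    have h := (convex_convexHull ℝ Φ') (subset_convexHull ℝ Φ' hv)
      (subset_convexHull ℝ Φ' (hneg v hv)) (a := 1 / 2) (b := 1 / 2)
      (by norm_num) (by norm_num) (by norm_num)
    simpa using h
  have hroot : ∀ p q : ℕ, p < q →
      partialSums n (basisOrZero n p - basisOrZero n q) ∈ insert 0 Φ' := by
    intro p q hpq
    by_cases hp : p < n
    · obtain ⟨i, j, hij, h⟩ := partialSums_sub_mem_root hpq hp
      right
      subst hΦ'
      exact ⟨i, j, hij, Or.inl h⟩
    · left
      funext l
      have := l.2
      rw [map_sub, Pi.sub_apply, partialSums_basisOrZero, partialSums_basisOrZero,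
        if_neg (by omega), if_neg (by omega)]
      simp
  have hsub : insert 0 Φ' ⊆ convexHull ℝ Φ' := Set.insert_subset hzero (subset_convexHull ℝ Φ')
  have hhull : convexHull ℝ Φ' = partialSums n '' signedSimplex n 1 1 := by
    rw [signedSimplex_one_one_eq_convexHull, LinearMap.image_convexHull]
    apply Set.Subset.antisymm
    · refine convexHull_mono ?_
      subst hΦ'
      rintro v ⟨i, j, hij, rfl | rfl⟩
      · exact ⟨_, ⟨i, j + 1, rfl⟩, (sum_Icc_indicator_eq i j hij).symm⟩
      · refine ⟨_, ⟨j + 1, i, rfl⟩, ?_⟩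
        rw [sum_Icc_indicator_eq i j hij, ← map_neg, neg_sub]
    · refine convexHull_min ?_ (convex_convexHull ℝ Φ')
      rintro _ ⟨_, ⟨p, q, rfl⟩, rfl⟩
      rcases lt_trichotomy p q with h | rfl | h
      · exact hsub (hroot p q h)
      · simpa using hzero
      · rw [← neg_sub, map_neg]
        rcases hroot q p h with h0 | h0
        · simpa [h0] using hzero
        · exact subset_convexHull ℝ Φ' (hneg _ h0)
  rw [hhull, Measure.addHaar_image_linearMap, det_partialSums, volume_signedSimplex_one_one]
  simp
end

section
/- Let n ≥ 1 and realize the type A_n root system in simple-root coordinates in ℝ^n, with positive roots Φ′⁺ = {v_{i,j} : 1 ≤ i ≤ j ≤ n} where v_{i,j} = e_i + ⋯ + e_j. Then the Lebesgue volume of the positive root polytope conv(Φ′⁺ ∪ {0}) satisfies (n+1) · vol(conv(Φ′⁺ ∪ {0})) = vol(conv(Φ′)), where Φ′ = Φ′⁺ ∪ (−Φ′⁺); equivalently, vol(conv(Φ′⁺ ∪ {0})) = C(2n,n)/((n+1) · n!), the n-th Catalan number divided by n!. -/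
open MeasureTheory

theorem volume_zeroLocus_linearMap {ι : Type*} [Fintype ι] (f : (ι → ℝ) →ₗ[ℝ] ℝ) (hf : f ≠ 0) :
    volume {x : ι → ℝ | f x = 0} = 0 :=
  Measure.addHaar_submodule volume (LinearMap.ker f) fun h => hf (LinearMap.ker_eq_top.1 h)

/-- Change the sign of the coordinates outside `s`. -/
def flipOutside {ι : Type*} [DecidableEq ι] (s : Finset ι) (y : ι → ℝ) : ι → ℝ :=
  fun i => if i ∈ s then y i else -y i

theorem measurePreserving_flipOutside {ι : Type*} [Fintype ι] [DecidableEq ι] (s : Finset ι) :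
    MeasurePreserving (flipOutside s) (volume : Measure (ι → ℝ)) volume := by
  refine volume_preserving_pi (f := fun i (t : ℝ) => if i ∈ s then t else -t) fun i => ?_
  by_cases h : i ∈ s
  · simp only [h, if_true]
    exact MeasurePreserving.id volume
  · simpa [h] using Measure.measurePreserving_neg (volume : Measure ℝ)

theorem flipOutside_flipOutside {ι : Type*} [DecidableEq ι] (s : Finset ι) (y : ι → ℝ) :
    flipOutside s (flipOutside s y) = y := by
  ext i
  by_cases h : i ∈ s <;> simp [flipOutside, h]

theorem volume_eq_sum_orthants {ι : Type*} [Fintype ι] [DecidableEq ι] {Q : Set (ι → ℝ)}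
    (hQ : MeasurableSet Q) :
    volume Q = ∑ s : Finset ι, volume {y : ι → ℝ | (∀ i, 0 ≤ y i) ∧ flipOutside s y ∈ Q} := by
  have hmeas (s : Finset ι) :
      MeasurableSet {y : ι → ℝ | (∀ i, 0 ≤ y i) ∧ flipOutside s y ∈ Q} := by
    have : {y : ι → ℝ | (∀ i, 0 ≤ y i) ∧ flipOutside s y ∈ Q} = Set.Ici 0 ∩ flipOutside s ⁻¹' Q := by
      ext y
      simp [Pi.le_def]
    rw [this]
    exact measurableSet_Ici.inter ((measurePreserving_flipOutside s).measurable hQ)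
  have hcover : Q = ⋃ s : Finset ι,
      flipOutside s ⁻¹' {y : ι → ℝ | (∀ i, 0 ≤ y i) ∧ flipOutside s y ∈ Q} := by
    ext y
    simp only [Set.mem_iUnion, Set.mem_preimage, Set.mem_ofPred_eq, flipOutside_flipOutside]
    refine ⟨fun hy => ⟨Finset.univ.filter fun i => 0 ≤ y i, fun i => ?_, hy⟩, fun ⟨_, _, hy⟩ => hy⟩
    by_cases h : 0 ≤ y i
    · simp [flipOutside, h]
    · simp [flipOutside, h, (not_le.1 h).le]
  conv_lhs => rw [hcover]
  rw [measure_iUnion₀, tsum_fintype]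
  · exact Finset.sum_congr rfl fun s _ =>
      (measurePreserving_flipOutside s).measure_preimage (hmeas s).nullMeasurableSet
  · intro s t hst
    obtain ⟨i, hi⟩ : ∃ i, ¬(i ∈ s ↔ i ∈ t) := by
      by_contra! h
      exact hst (Finset.ext h)
    refine measure_mono_null ?_ (volume_zeroLocus_linearMap (LinearMap.proj i) fun h => ?_)
    · rintro y ⟨⟨h₁, -⟩, h₂, -⟩
      have h₁ := h₁ i
      have h₂ := h₂ i
      simp only [flipOutside] at h₁ h₂
      simp only [Set.mem_ofPred_eq, LinearMap.proj_apply]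
      split_ifs at h₁ h₂ <;> first | tauto | linarith
    · simpa using LinearMap.congr_fun h (fun _ => (1 : ℝ))
  · exact fun s => ((measurePreserving_flipOutside s).measurable (hmeas s)).nullMeasurableSet

theorem volume_corner_simplex (ι : Type*) [Fintype ι] :
    volume {y : ι → ℝ | (∀ i, 0 ≤ y i) ∧ ∑ i, y i ≤ 1}
      = ((Fintype.card ι).factorial : ENNReal)⁻¹ := by
  classical
  rcases isEmpty_or_nonempty ι with h | h
  · simp [volume_pi]
  have hball := volume_sum_rpow_le (ι := ι) (p := 1) le_rfl 1
  simp only [Real.rpow_one, div_one, ENNReal.ofReal_one, one_pow, one_mul, one_add_one_eq_two,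
    Real.Gamma_two, mul_one, Real.Gamma_nat_eq_factorial] at hball
  rw [volume_eq_sum_orthants (measurableSet_le (by fun_prop) measurable_const)] at hball
  have hpiece (s : Finset ι) :
      {y : ι → ℝ | (∀ i, 0 ≤ y i) ∧ flipOutside s y ∈ {x : ι → ℝ | ∑ i, |x i| ≤ 1}}
        = {y : ι → ℝ | (∀ i, 0 ≤ y i) ∧ ∑ i, y i ≤ 1} := by
    ext y
    refine and_congr_right fun hy => ?_
    have (i : ι) : |flipOutside s y i| = y i := by
      by_cases h : i ∈ s <;> simp [flipOutside, h, abs_of_nonneg (hy i)]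
    simp [this]
  simp only [hpiece, Finset.sum_const, Finset.card_univ, Fintype.card_finset, nsmul_eq_mul] at hball
  rw [ENNReal.ofReal_div_of_pos (by positivity), ENNReal.ofReal_pow (by norm_num),
    ENNReal.ofReal_natCast, div_eq_mul_inv] at hball
  push_cast at hball
  rw [ENNReal.ofReal_ofNat] at hball
  exact (ENNReal.mul_right_inj (by simp) (by simp)).1 hball

theorem volume_corner_simplex_prod {ι : Type*} [Fintype ι] [DecidableEq ι] (s : Finset ι) :
    volume {y : ι → ℝ | (∀ i, 0 ≤ y i) ∧ ∑ i ∈ s, y i ≤ 1 ∧ ∑ i ∈ sᶜ, y i ≤ 1}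
      = (s.card.factorial : ENNReal)⁻¹ * ((Fintype.card ι - s.card).factorial : ENNReal)⁻¹ := by
  have hpre : {y : ι → ℝ | (∀ i, 0 ≤ y i) ∧ ∑ i ∈ s, y i ≤ 1 ∧ ∑ i ∈ sᶜ, y i ≤ 1}
      = MeasurableEquiv.piEquivPiSubtypeProd (fun _ => ℝ) (· ∈ s) ⁻¹'
        ({y | (∀ i, 0 ≤ y i) ∧ ∑ i, y i ≤ 1} ×ˢ {y | (∀ i, 0 ≤ y i) ∧ ∑ i, y i ≤ 1}) := by
    ext y
    have h₁ : ∑ i : {i // i ∈ s}, y i = ∑ i ∈ s, y i := Finset.sum_coe_sort s y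
    have h₂ : ∑ i : {i // i ∉ s}, y i = ∑ i ∈ sᶜ, y i :=
      (Finset.sum_subtype sᶜ (by simp) y).symm
    simp only [MeasurableEquiv.piEquivPiSubtypeProd, Set.mem_ofPred_eq, Set.mem_preimage,
      Set.mem_prod, MeasurableEquiv.coe_mk, Equiv.piEquivPiSubtypeProd, Equiv.coe_fn_mk, h₁, h₂,
      Subtype.forall]
    grind
  rw [hpre, (volume_preserving_piEquivPiSubtypeProd (fun _ : ι => ℝ) (· ∈ s)).measure_preimage_equiv,
    Measure.volume_eq_prod, Measure.prod_prod, volume_corner_simplex {i // i ∉ s}]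
  have h := volume_corner_simplex {i // i ∈ s}
  have hcard : Fintype.card {i // i ∉ s} = Fintype.card ι - s.card := by
    simp [Fintype.card_subtype_compl]
  rw [Fintype.card_coe] at h
  rw [← h, hcard]
  congr!

theorem volume_posPart_negPart_sum_le_one (n : ℕ) :
    volume {z : Fin n → ℝ | ∑ i, max (z i) 0 ≤ 1 ∧ ∑ i, max (-z i) 0 ≤ 1}
      = ((2 * n).choose n : ENNReal) / n.factorial := by
  have hmeas : MeasurableSet {z : Fin n → ℝ | ∑ i, max (z i) 0 ≤ 1 ∧ ∑ i, max (-z i) 0 ≤ 1} := by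
    rw [Set.ofPred_and]
    exact (measurableSet_le (by fun_prop) measurable_const).inter
      (measurableSet_le (by fun_prop) measurable_const)
  have hpiece (s : Finset (Fin n)) :
      {y : Fin n → ℝ | (∀ i, 0 ≤ y i) ∧ flipOutside s y ∈
        {z : Fin n → ℝ | ∑ i, max (z i) 0 ≤ 1 ∧ ∑ i, max (-z i) 0 ≤ 1}}
        = {y | (∀ i, 0 ≤ y i) ∧ ∑ i ∈ s, y i ≤ 1 ∧ ∑ i ∈ sᶜ, y i ≤ 1} := by
    ext y
    refine and_congr_right fun hy => ?_
    have h₁ (i : Fin n) : max (flipOutside s y i) 0 = if i ∈ s then y i else 0 := by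
      by_cases h : i ∈ s <;> simp [flipOutside, h, hy i]
    have h₂ (i : Fin n) : max (-flipOutside s y i) 0 = if i ∈ sᶜ then y i else 0 := by
      by_cases h : i ∈ s <;> simp [flipOutside, h, hy i]
    simp only [Set.mem_ofPred_eq, h₁, h₂, Finset.sum_ite_mem, Finset.univ_inter]
  have hterm (k : ℕ) (hk : k ∈ Finset.range (n + 1)) :
      n.choose k • ((k.factorial : ENNReal)⁻¹ * ((n - k).factorial : ENNReal)⁻¹)
        = ((n.choose k ^ 2 : ℕ) : ENNReal) * (n.factorial : ENNReal)⁻¹ := by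
    have hfac := Nat.choose_mul_factorial_mul_factorial (Finset.mem_range_succ_iff.1 hk)
    have hinv : (k.factorial : ENNReal)⁻¹ * ((n - k).factorial : ENNReal)⁻¹
        = n.choose k * (n.factorial : ENNReal)⁻¹ := by
      rw [← hfac]
      push_cast
      have hne : (n.choose k : ENNReal) ≠ 0 := by
        exact_mod_cast (Nat.choose_pos (Finset.mem_range_succ_iff.1 hk)).ne'
      rw [mul_assoc (n.choose k : ENNReal), ENNReal.mul_inv (.inl hne) (.inl (by simp)),
        ← mul_assoc (n.choose k : ENNReal),
        ENNReal.mul_inv_cancel hne (by simp), one_mul,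
        ENNReal.mul_inv (.inl (by simp [Nat.factorial_ne_zero])) (.inl (by simp))]
    rw [hinv, nsmul_eq_mul]
    push_cast
    ring
  rw [volume_eq_sum_orthants hmeas]
  simp only [hpiece, volume_corner_simplex_prod, Fintype.card_fin]
  rw [← Finset.powerset_univ, Finset.sum_powerset_apply_card
      (fun k => (k.factorial : ENNReal)⁻¹ * ((n - k).factorial : ENNReal)⁻¹)]
  simp only [Finset.card_univ, Fintype.card_fin]
  rw [Finset.sum_congr rfl hterm, ← Finset.sum_mul, ← Nat.cast_sum, Nat.sum_range_choose_sq,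
    div_eq_mul_inv]

theorem mem_smul_of_exchange {ι : Type*} [Fintype ι] [DecidableEq ι] {K : Set (ι → ℝ)}
    (hK : Convex ℝ K) (h0 : 0 ∈ K) {C : (ι → ℝ) → Prop}
    (hC : ∀ y, C y → y ≠ 0 → ∃ i j, 0 < y i ∧ y j < 0 ∧
      (Pi.single i 1 - Pi.single j 1 : ι → ℝ) ∈ K ∧
      C (y - min (y i) (-y j) • (Pi.single i 1 - Pi.single j 1))) {y : ι → ℝ} (hy : C y) :
    ∃ v ∈ K, y = (∑ i, max (y i) 0) • v := by
  induction hN : (Finset.univ.filter fun i => y i ≠ 0).card using Nat.strong_induction_on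
    generalizing y with
  | _ N ih =>
  by_cases hy0 : y = 0
  · exact ⟨0, h0, by simp [hy0]⟩
  obtain ⟨i, j, hi, hj, hd, hC'⟩ := hC y hy hy0
  set t := min (y i) (-y j) with ht
  set d : ι → ℝ := Pi.single i 1 - Pi.single j 1 with hdd
  have hij : i ≠ j := by
    rintro rfl
    linarith
  have htpos : 0 < t := lt_min hi (by linarith)
  have hti : t ≤ y i := min_le_left _ _
  have htj : t ≤ -y j := min_le_right _ _
  have hdi : d i = 1 := by simp [hdd, hij]
  have hdj : d j = -1 := by simp [hdd, hij.symm]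
  have hdl (l : ι) (h₁ : l ≠ i) (h₂ : l ≠ j) : d l = 0 := by simp [hdd, h₁, h₂]
  have hval (l : ι) : (y - t • d) l = y l - t * d l := rfl
  have hsum : ∑ l, max ((y - t • d) l) 0 = ∑ l, max (y l) 0 - t := by
    have (l : ι) : max ((y - t • d) l) 0 = max (y l) 0 - if l = i then t else 0 := by
      rw [hval]
      by_cases h₁ : l = i
      · subst h₁
        rw [hdi, if_pos rfl, max_eq_left (by linarith), max_eq_left (by linarith)]
        ring
      by_cases h₂ : l = j
      · subst h₂
        rw [hdj, if_neg h₁, max_eq_right (by linarith), max_eq_right (by linarith)]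
        ring
      · rw [hdl l h₁ h₂, if_neg h₁]
        simp
    simp only [this, Finset.sum_sub_distrib, Finset.sum_ite_eq', Finset.mem_univ, if_true]
  have hlt : (Finset.univ.filter fun l => (y - t • d) l ≠ 0).card < N := by
    rw [← hN]
    refine Finset.card_lt_card (Finset.ssubset_iff_of_subset (fun l hl => ?_) |>.2 ?_)
    · simp only [Finset.mem_filter, Finset.mem_univ, true_and, hval] at hl ⊢
      by_cases h₁ : l = i
      · exact h₁ ▸ hi.ne'
      by_cases h₂ : l = j
      · exact h₂ ▸ hj.ne
      · simpa [hdl l h₁ h₂] using hl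
    · rcases min_choice (y i) (-y j) with h | h
      · exact ⟨i, by simp [hi.ne'], by simp [ht, hdi, h]⟩
      · exact ⟨j, by simp [hj.ne], by simp [ht, hdj, h]⟩
  obtain ⟨v, hv, hyv⟩ := ih _ hlt hC' rfl
  rw [hsum] at hyv
  have hle : 0 ≤ ∑ l, max (y l) 0 - t := by
    rw [← hsum]
    exact Finset.sum_nonneg fun _ _ => le_max_right _ _
  obtain ⟨w, hw, hw'⟩ := hK.exists_mem_add_smul_eq hv hd hle htpos.le
  refine ⟨w, hw, ?_⟩
  rw [sub_add_cancel] at hw'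
  rw [hw', ← hyv, sub_add_cancel]

theorem mem_smul_of_sum_eq_zero {ι : Type*} [Fintype ι] [DecidableEq ι] {K : Set (ι → ℝ)}
    (hK : Convex ℝ K) (h0 : 0 ∈ K)
    (hd : ∀ i j, i ≠ j → (Pi.single i 1 - Pi.single j 1 : ι → ℝ) ∈ K) {y : ι → ℝ}
    (hy : ∑ i, y i = 0) : ∃ v ∈ K, y = (∑ i, max (y i) 0) • v := by
  refine mem_smul_of_exchange hK h0 (C := fun y => ∑ i, y i = 0) (fun y hy hy0 => ?_) hy
  obtain ⟨l, hl⟩ := Function.ne_iff.1 hy0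
  obtain ⟨i, -, hi⟩ := Finset.exists_pos_of_sum_zero_of_exists_nonzero y hy ⟨l, by simp, hl⟩
  obtain ⟨j, -, hj⟩ := Finset.exists_pos_of_sum_zero_of_exists_nonzero (-y) (by simpa using hy)
    ⟨l, by simp, by simpa using hl⟩
  have hj : y j < 0 := by simpa using hj
  refine ⟨i, j, hi, hj, hd i j ?_, ?_⟩
  · rintro rfl
    linarith
  · simp [Finset.sum_sub_distrib, ← Finset.mul_sum, hy]

theorem mem_smul_of_prefix_sums_nonneg {N : ℕ} {K : Set (Fin N → ℝ)}
    (hK : Convex ℝ K) (h0 : 0 ∈ K)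
    (hd : ∀ i j, i < j → (Pi.single i 1 - Pi.single j 1 : Fin N → ℝ) ∈ K) {y : Fin N → ℝ}
    (hy : ∑ i, y i = 0) (hpre : ∀ k, 0 ≤ ∑ m ∈ Finset.Iic k, y m) :
    ∃ v ∈ K, y = (∑ i, max (y i) 0) • v := by
  refine mem_smul_of_exchange hK h0
    (C := fun y => ∑ i, y i = 0 ∧ ∀ k, 0 ≤ ∑ m ∈ Finset.Iic k, y m) ?_ ⟨hy, hpre⟩
  rintro y ⟨hy, hpre⟩ hy0
  obtain ⟨l, hl⟩ := Function.ne_iff.1 hy0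
  obtain ⟨j₀, -, hj₀⟩ := Finset.exists_pos_of_sum_zero_of_exists_nonzero (-y) (by simpa using hy)
    ⟨l, by simp, by simpa using hl⟩
  obtain ⟨j, hj, hmin⟩ := WellFounded.has_min (wellFounded_lt (α := Fin N)) {j | y j < 0}
    ⟨j₀, by simpa using hj₀⟩
  have hj : y j < 0 := hj
  have hnonneg (m : Fin N) (hm : m < j) : 0 ≤ y m := by
    by_contra! h
    exact hmin m h hm
  obtain ⟨i, hij, hi⟩ : ∃ i < j, 0 < y i := by
    by_contra! h
    have h₁ := hpre j
    rw [← Finset.Iio_insert, Finset.sum_insert (by simp)] at h₁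
    have h₂ : ∑ m ∈ Finset.Iio j, y m ≤ 0 :=
      Finset.sum_nonpos fun m hm => h m (Finset.mem_Iio.1 hm)
    linarith
  refine ⟨i, j, hi, hj, hd i j hij, ?_, fun k => ?_⟩
  · simp [Finset.sum_sub_distrib, ← Finset.mul_sum, hy]
  · simp only [Pi.sub_apply, Pi.smul_apply, smul_eq_mul, Finset.sum_sub_distrib, ← Finset.mul_sum,
      Finset.sum_pi_single', Finset.mem_Iic]
    have hk := hpre k
    by_cases hik : i ≤ k
    · by_cases hjk : j ≤ k
      · simpa [hik, hjk] using hk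
      · have h₁ : y i ≤ ∑ m ∈ Finset.Iic k, y m :=
          Finset.single_le_sum (f := y)
            (fun m hm => hnonneg m ((Finset.mem_Iic.1 hm).trans_lt (not_le.1 hjk)))
            (Finset.mem_Iic.2 hik)
        have h₂ : min (y i) (-y j) ≤ y i := min_le_left _ _
        simp only [hik, hjk, if_true, if_false]
        linarith
    · have hjk : ¬ j ≤ k := fun h => hik (hij.le.trans h)
      simpa [hik, hjk] using hk

/-- The vector `(0, x₁, …, xₙ)`, viewed as a function on the cyclic group `Fin (n + 1)`. -/
def padZero (n : ℕ) : (Fin n → ℝ) →ₗ[ℝ] (Fin (n + 1) → ℝ) where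
  toFun x := Fin.cons 0 x
  map_add' x y := by
    ext i
    cases i using Fin.cases <;> simp
  map_smul' c x := by
    ext i
    cases i using Fin.cases <;> simp

@[simp]
theorem padZero_zero {n : ℕ} (x : Fin n → ℝ) : padZero n x 0 = 0 := rfl

@[simp]
theorem padZero_succ {n : ℕ} (x : Fin n → ℝ) (i : Fin n) : padZero n x i.succ = x i := rfl

/-- The cyclic differences of `(0, x₁, …, xₙ)`. -/
def cyclicDiff (n : ℕ) : (Fin n → ℝ) →ₗ[ℝ] (Fin (n + 1) → ℝ) where
  toFun x i := padZero n x (i + 1) - padZero n x i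
  map_add' x y := by
    ext i
    simp only [map_add, Pi.add_apply]
    ring
  map_smul' c x := by
    ext i
    simp only [map_smul, Pi.smul_apply, smul_eq_mul, RingHom.id_apply]
    ring

theorem cyclicDiff_apply {n : ℕ} (x : Fin n → ℝ) (i : Fin (n + 1)) :
    cyclicDiff n x i = padZero n x (i + 1) - padZero n x i := rfl

theorem sum_Iic_cyclicDiff {n : ℕ} (x : Fin n → ℝ) (k : Fin (n + 1)) :
    ∑ m ∈ Finset.Iic k, cyclicDiff n x m = padZero n x (k + 1) := by
  induction k using Fin.induction with
  | zero =>
    have : Finset.Iic (0 : Fin (n + 1)) = {0} := by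
      ext
      simp
    rw [this, Finset.sum_singleton, cyclicDiff_apply, padZero_zero, sub_zero]
  | succ i ih =>
    have : Finset.Iic i.succ = insert i.succ (Finset.Iic i.castSucc) := by
      ext m
      simp only [Finset.mem_Iic, Finset.mem_insert, Fin.le_def, Fin.ext_iff, Fin.val_succ,
        Fin.val_castSucc]
      omega
    rw [this, Finset.sum_insert (by simp), ih, cyclicDiff_apply, Fin.coeSucc_eq_succ]
    ring

theorem sum_cyclicDiff {n : ℕ} (x : Fin n → ℝ) : ∑ m, cyclicDiff n x m = 0 := by
  have h := sum_Iic_cyclicDiff x (Fin.last n)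
  rwa [Fin.last_add_one, padZero_zero, ← Fin.top_eq_last, Finset.Iic_top] at h

/-- The total ascent of the closed path `0, x₁, …, xₙ, 0`. -/
def cyclicAscent {n : ℕ} (x : Fin n → ℝ) : ℝ := ∑ i, max (cyclicDiff n x i) 0

theorem cyclicAscent_neg {n : ℕ} (x : Fin n → ℝ) : cyclicAscent (-x) = cyclicAscent x := by
  have h : ∑ i, (max (cyclicDiff n x i) 0 - max (-cyclicDiff n x i) 0) = 0 := by
    refine (Finset.sum_congr rfl fun i _ => ?_).trans (sum_cyclicDiff x)
    exact max_zero_sub_max_neg_zero_eq_self _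
  rw [Finset.sum_sub_distrib] at h
  simp only [cyclicAscent, map_neg, Pi.neg_apply]
  linarith

theorem convex_cyclicAscent_le_one (n : ℕ) : Convex ℝ {x : Fin n → ℝ | cyclicAscent x ≤ 1} := by
  intro x hx y hy a b ha hb hab
  simp only [Set.mem_ofPred_eq] at hx hy ⊢
  have h : cyclicAscent (a • x + b • y) ≤ a * cyclicAscent x + b * cyclicAscent y := by
    simp only [cyclicAscent, Finset.mul_sum, ← Finset.sum_add_distrib]
    refine Finset.sum_le_sum fun i _ => ?_
    simp only [map_add, map_smul, Pi.add_apply, Pi.smul_apply, smul_eq_mul]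
    have hx₁ := mul_le_mul_of_nonneg_left (le_max_left (cyclicDiff n x i) 0) ha
    have hx₂ := mul_nonneg ha (le_max_right (cyclicDiff n x i) 0)
    have hy₁ := mul_le_mul_of_nonneg_left (le_max_left (cyclicDiff n y i) 0) hb
    have hy₂ := mul_nonneg hb (le_max_right (cyclicDiff n y i) 0)
    exact max_le (by linarith) (by linarith)
  nlinarith

/-- The positive roots of type `A_n` in simple-root coordinates. -/
def positiveRootsA (n : ℕ) : Set (Fin n → ℝ) :=
  {v | ∃ i j : Fin n, i ≤ j ∧ v = fun m => if i ≤ m ∧ m ≤ j then 1 else 0}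

/-- The positive root polytope of type `A_n`, described by inequalities. -/
def ascentCorner (n : ℕ) : Set (Fin n → ℝ) := {x | (∀ i, 0 ≤ x i) ∧ cyclicAscent x ≤ 1}

theorem positiveRootsA_subset (n : ℕ) : positiveRootsA n ⊆ ascentCorner n := by
  rintro v ⟨i, j, hij, rfl⟩
  refine ⟨fun m => by dsimp only; split_ifs <;> norm_num, ?_⟩
  set v : Fin n → ℝ := fun m => if i ≤ m ∧ m ≤ j then 1 else 0 with hv
  have hpad (m : Fin (n + 1)) : padZero n v m = if i.succ ≤ m ∧ m ≤ j.succ then 1 else 0 := by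
    cases m using Fin.cases <;> simp [hv]
  calc cyclicAscent v ≤ ∑ m, if m = i.castSucc then (1 : ℝ) else 0 :=
        Finset.sum_le_sum fun m _ => ?_
    _ = 1 := by simp
  rw [cyclicDiff_apply]
  cases m using Fin.lastCases with
  | last =>
    rw [Fin.last_add_one, padZero_zero, hpad]
    split_ifs <;> norm_num
  | cast m =>
    rw [Fin.coeSucc_eq_succ, hpad, hpad]
    simp only [Fin.le_def, Fin.ext_iff, Fin.val_succ, Fin.val_castSucc]
    split_ifs <;> first | omega | norm_num

/-- The linear map recovering a path from its cyclic differences. -/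
def pathOfDiff (n : ℕ) : (Fin (n + 1) → ℝ) →ₗ[ℝ] (Fin n → ℝ) where
  toFun y i := ∑ m ∈ Finset.Iic i.castSucc, y m
  map_add' x y := by
    ext i
    simp [Finset.sum_add_distrib]
  map_smul' c x := by
    ext i
    simp [Finset.mul_sum]

theorem pathOfDiff_cyclicDiff {n : ℕ} (x : Fin n → ℝ) : pathOfDiff n (cyclicDiff n x) = x := by
  ext i
  exact (sum_Iic_cyclicDiff x i.castSucc).trans (by rw [Fin.coeSucc_eq_succ, padZero_succ])

theorem pathOfDiff_single_sub_single_mem {n : ℕ} {a b : Fin (n + 1)} (hab : a < b) :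
    pathOfDiff n (Pi.single a 1 - Pi.single b 1) ∈ positiveRootsA n := by
  obtain ⟨a, rfl⟩ : ∃ a' : Fin n, a = a'.castSucc :=
    ⟨a.castPred (Fin.ne_last_of_lt hab), by simp⟩
  obtain ⟨b, rfl⟩ : ∃ b' : Fin n, b = b'.succ :=
    ⟨b.pred (Fin.ne_zero_of_lt hab), by simp⟩
  refine ⟨a, b, Fin.castSucc_lt_succ_iff.1 hab, ?_⟩
  ext m
  simp only [pathOfDiff, LinearMap.coe_mk, AddHom.coe_mk, Pi.sub_apply, Finset.sum_sub_distrib,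
    Finset.sum_pi_single', Finset.mem_Iic]
  simp only [Fin.le_def, Fin.lt_def, Fin.val_succ, Fin.val_castSucc] at hab ⊢
  split_ifs <;> first | omega | norm_num

theorem mem_of_cyclicDiff_eq_smul {n : ℕ} {S : Set (Fin n → ℝ)} (hS : Convex ℝ S) (h0 : 0 ∈ S)
    {x : Fin n → ℝ} (hx : cyclicAscent x ≤ 1)
    (h : ∃ v ∈ pathOfDiff n ⁻¹' S, cyclicDiff n x = cyclicAscent x • v) : x ∈ S := by
  obtain ⟨v, hv, hxv⟩ := h
  rw [← pathOfDiff_cyclicDiff x, hxv, map_smul]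
  exact hS.smul_mem_of_zero_mem h0 hv ⟨Finset.sum_nonneg fun _ _ => le_max_right _ _, hx⟩

theorem convexHull_positiveRootsA (n : ℕ) :
    convexHull ℝ (positiveRootsA n ∪ {0}) = ascentCorner n := by
  apply subset_antisymm
  · refine convexHull_min (Set.union_subset (positiveRootsA_subset n) ?_) ?_
    · simp [ascentCorner, cyclicAscent]
    · have : ascentCorner n = Set.Ici 0 ∩ {x | cyclicAscent x ≤ 1} := by
        ext x
        simp [ascentCorner, Pi.le_def]
      rw [this]
      exact (convex_Ici 0).inter (convex_cyclicAscent_le_one n)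
  · rintro x ⟨hx, hx'⟩
    have hsub := subset_convexHull ℝ (positiveRootsA n ∪ {0})
    have hconv := convex_convexHull ℝ (positiveRootsA n ∪ {0})
    have h0 := hsub (Or.inr rfl)
    refine mem_of_cyclicDiff_eq_smul hconv h0 hx' (mem_smul_of_prefix_sums_nonneg
      (hconv.linear_preimage _) (by simpa using h0)
      (fun a b hab => hsub (Or.inl (pathOfDiff_single_sub_single_mem hab)))
      (sum_cyclicDiff x) fun k => ?_)
    rw [sum_Iic_cyclicDiff]
    generalize k + 1 = l
    cases l using Fin.cases <;> simp [hx]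

theorem convexHull_rootsA {n : ℕ} (hn : 1 ≤ n) :
    convexHull ℝ (positiveRootsA n ∪ -positiveRootsA n) = {x | cyclicAscent x ≤ 1} := by
  apply subset_antisymm
  · refine convexHull_min (Set.union_subset (fun v hv => (positiveRootsA_subset n hv).2)
      fun v hv => ?_) (convex_cyclicAscent_le_one n)
    rw [Set.mem_ofPred_eq, ← cyclicAscent_neg]
    exact (positiveRootsA_subset n hv).2
  · intro x hx
    have hsub := subset_convexHull ℝ (positiveRootsA n ∪ -positiveRootsA n)
    have hconv := convex_convexHull ℝ (positiveRootsA n ∪ -positiveRootsA n)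
    have h0 : (0 : Fin n → ℝ) ∈ convexHull ℝ (positiveRootsA n ∪ -positiveRootsA n) := by
      obtain ⟨v, hv⟩ : (positiveRootsA n).Nonempty := ⟨_, ⟨0, hn⟩, ⟨0, hn⟩, le_rfl, rfl⟩
      have := hconv (hsub (Or.inl hv)) (hsub (Or.inr (Set.neg_mem_neg.2 hv)))
        (by norm_num : (0 : ℝ) ≤ 1 / 2) (by norm_num : (0 : ℝ) ≤ 1 / 2) (by norm_num)
      simpa using this
    refine mem_of_cyclicDiff_eq_smul hconv h0 hx (mem_smul_of_sum_eq_zero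
      (hconv.linear_preimage _) (by simpa using h0) (fun a b hab => hsub ?_) (sum_cyclicDiff x))
    rcases hab.lt_or_gt with h | h
    · exact Or.inl (pathOfDiff_single_sub_single_mem h)
    · refine Or.inr ?_
      rw [Set.mem_neg, ← map_neg, neg_sub]
      exact pathOfDiff_single_sub_single_mem h

/-- Cyclic rotation by `k` of the closed path `0, x₁, …, xₙ, 0`, translated to start at `0`. -/
def rotatePath (n : ℕ) (k : Fin (n + 1)) : (Fin n → ℝ) →ₗ[ℝ] (Fin n → ℝ) where
  toFun x i := padZero n x (i.succ + k) - padZero n x k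
  map_add' x y := by
    ext i
    simp only [map_add, Pi.add_apply]
    ring
  map_smul' c x := by
    ext i
    simp only [map_smul, Pi.smul_apply, smul_eq_mul, RingHom.id_apply]
    ring

theorem padZero_rotatePath {n : ℕ} (k : Fin (n + 1)) (x : Fin n → ℝ) (i : Fin (n + 1)) :
    padZero n (rotatePath n k x) i = padZero n x (i + k) - padZero n x k := by
  cases i using Fin.cases
  · simp
  · rfl

theorem rotatePath_zero (n : ℕ) : rotatePath n 0 = 1 := by
  ext1 x
  ext i
  simp [rotatePath]

theorem rotatePath_add (n : ℕ) (k l : Fin (n + 1)) :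
    rotatePath n (k + l) = rotatePath n k * rotatePath n l := by
  refine LinearMap.ext fun x => funext fun i => ?_
  change padZero n x (i.succ + (k + l)) - padZero n x (k + l) =
    padZero n (rotatePath n l x) (i.succ + k) - padZero n (rotatePath n l x) k
  rw [padZero_rotatePath, padZero_rotatePath, add_assoc]
  ring

theorem rotatePath_nsmul (n : ℕ) (k : Fin (n + 1)) (m : ℕ) :
    rotatePath n (m • k) = rotatePath n k ^ m := by
  induction m with
  | zero => rw [zero_nsmul, rotatePath_zero, pow_zero]
  | succ m ih => rw [succ_nsmul, rotatePath_add, ih, pow_succ]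

theorem abs_det_rotatePath (n : ℕ) (k : Fin (n + 1)) : |LinearMap.det (rotatePath n k)| = 1 := by
  have h : (n + 1) • k = 0 := by simpa using card_nsmul_eq_zero' (x := k)
  have hdet : LinearMap.det (rotatePath n k) ^ (n + 1) = 1 := by
    rw [← map_pow, ← rotatePath_nsmul, h, rotatePath_zero, map_one]
  have habs : |LinearMap.det (rotatePath n k)| ^ (n + 1) = 1 := by rw [← abs_pow, hdet, abs_one]
  exact (pow_eq_one_iff_of_nonneg (abs_nonneg _) n.succ_ne_zero).1 habs

theorem volume_preimage_of_abs_det_eq_one {ι : Type*} [Fintype ι] {f : (ι → ℝ) →ₗ[ℝ] (ι → ℝ)}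
    (hf : |LinearMap.det f| = 1) (s : Set (ι → ℝ)) : volume (f ⁻¹' s) = volume s := by
  have h0 : LinearMap.det f ≠ 0 := fun h => by simp [h] at hf
  rw [Measure.addHaar_preimage_linearMap volume h0, abs_inv, hf]
  simp

theorem cyclicAscent_rotatePath {n : ℕ} (k : Fin (n + 1)) (x : Fin n → ℝ) :
    cyclicAscent (rotatePath n k x) = cyclicAscent x := by
  refine (Finset.sum_congr rfl fun i _ => ?_).trans
    (Equiv.sum_comp (Equiv.addRight k) fun i => max (cyclicDiff n x i) 0)
  simp only [cyclicDiff_apply, padZero_rotatePath, Equiv.coe_addRight, add_right_comm i 1 k,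
    sub_sub_sub_cancel_right]

theorem rotatePath_mem_ascentCorner {n : ℕ} {k : Fin (n + 1)} {x : Fin n → ℝ} :
    rotatePath n k x ∈ ascentCorner n ↔
      (∀ i, padZero n x k ≤ padZero n x i) ∧ cyclicAscent x ≤ 1 := by
  refine and_congr ?_ (by rw [cyclicAscent_rotatePath])
  change (∀ i : Fin n, 0 ≤ padZero n x (i.succ + k) - padZero n x k) ↔ _
  refine ⟨fun h i => ?_, fun h i => sub_nonneg.2 (h _)⟩
  obtain ⟨j, rfl⟩ := (Equiv.addRight k).surjective i
  cases j using Fin.cases with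
  | zero => simp
  | succ j => exact sub_nonneg.1 (h j)

theorem measurableSet_ascentCorner (n : ℕ) : MeasurableSet (ascentCorner n) := by
  have hasc : Measurable (cyclicAscent (n := n)) := by
    have h (i : Fin (n + 1)) : Measurable fun x => cyclicDiff n x i :=
      (measurable_pi_apply i).comp (LinearMap.continuous_of_finiteDimensional _).measurable
    exact Finset.measurable_sum _ fun i _ => (h i).max measurable_const
  have : ascentCorner n = Set.Ici 0 ∩ {x | cyclicAscent x ≤ 1} := by
    ext x
    simp [ascentCorner, Pi.le_def]
  rw [this]
  exact measurableSet_Ici.inter (measurableSet_le hasc measurable_const)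

theorem succ_mul_volume_ascentCorner (n : ℕ) :
    ((n : ENNReal) + 1) * volume (ascentCorner n) = volume {x : Fin n → ℝ | cyclicAscent x ≤ 1} := by
  have hcover : {x : Fin n → ℝ | cyclicAscent x ≤ 1} = ⋃ k, rotatePath n k ⁻¹' ascentCorner n := by
    ext x
    simp only [Set.mem_iUnion, Set.mem_preimage, rotatePath_mem_ascentCorner, Set.mem_ofPred_eq]
    refine ⟨fun hx => ?_, fun ⟨_, _, hx⟩ => hx⟩
    obtain ⟨k, hk⟩ := Finite.exists_min (padZero n x)
    exact ⟨k, hk, hx⟩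
  have hmeas (k : Fin (n + 1)) : MeasurableSet (rotatePath n k ⁻¹' ascentCorner n) :=
    (LinearMap.continuous_of_finiteDimensional _).measurable (measurableSet_ascentCorner n)
  rw [hcover, measure_iUnion₀ _ fun k => (hmeas k).nullMeasurableSet]
  · simp [volume_preimage_of_abs_det_eq_one (abs_det_rotatePath n _), tsum_fintype]
  · intro k l hkl
    let f : (Fin n → ℝ) →ₗ[ℝ] ℝ :=
      LinearMap.proj k ∘ₗ padZero n - LinearMap.proj l ∘ₗ padZero n
    have hf (x : Fin n → ℝ) : f x = padZero n x k - padZero n x l := rfl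
    refine measure_mono_null (fun x hx => ?_) (volume_zeroLocus_linearMap f fun h => ?_)
    · rw [Set.mem_ofPred_eq, hf, sub_eq_zero]
      exact le_antisymm ((rotatePath_mem_ascentCorner.1 hx.1).1 l)
        ((rotatePath_mem_ascentCorner.1 hx.2).1 k)
    · have hinj (x : Fin n → ℝ) : padZero n x k = padZero n x l := by
        rw [← sub_eq_zero, ← hf, h, LinearMap.zero_apply]
      have := hinj fun i => (i : ℝ) + 1
      have hpad (m : Fin (n + 1)) : padZero n (fun i => (i : ℝ) + 1) m = m := by
        cases m using Fin.cases <;> simp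
      rw [hpad, hpad] at this
      exact hkl (Fin.ext (by exact_mod_cast this))

/-- The differences of consecutive entries of `(0, x₁, …, xₙ)`. -/
def consecutiveDiff (n : ℕ) : (Fin n → ℝ) →ₗ[ℝ] (Fin n → ℝ) :=
  LinearMap.funLeft ℝ ℝ Fin.castSucc ∘ₗ cyclicDiff n

theorem consecutiveDiff_apply {n : ℕ} (x : Fin n → ℝ) (i : Fin n) :
    consecutiveDiff n x i = x i - padZero n x i.castSucc := by
  change cyclicDiff n x i.castSucc = _
  rw [cyclicDiff_apply, Fin.coeSucc_eq_succ, padZero_succ]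

theorem det_consecutiveDiff (n : ℕ) : LinearMap.det (consecutiveDiff n) = 1 := by
  have hpad {i j : Fin n} (hij : i ≤ j) : padZero n (Pi.single j 1) i.castSucc = 0 := by
    generalize hm : i.castSucc = m
    cases m using Fin.cases with
    | zero => rfl
    | succ l =>
      refine Pi.single_eq_of_ne (fun h => ?_) _
      simp only [Fin.ext_iff, Fin.le_def, Fin.val_succ, Fin.val_castSucc] at hm hij h
      omega
  have hentry (i j : Fin n) : LinearMap.toMatrix' (consecutiveDiff n) i j =
      (Pi.single j 1 : Fin n → ℝ) i - padZero n (Pi.single j 1) i.castSucc := by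
    rw [LinearMap.toMatrix'_apply, consecutiveDiff_apply]
  rw [← LinearMap.det_toMatrix', Matrix.det_of_isLowerTriangular]
  · exact Finset.prod_eq_one fun i _ => by rw [hentry, hpad le_rfl]; simp
  · intro i j hij
    have hij : i < j := hij
    rw [hentry, hpad hij.le, Pi.single_eq_of_ne hij.ne, sub_zero]

theorem volume_cyclicAscent_le_one (n : ℕ) :
    volume {x : Fin n → ℝ | cyclicAscent x ≤ 1} = ((2 * n).choose n : ENNReal) / n.factorial := by
  rw [← volume_posPart_negPart_sum_le_one,
    ← volume_preimage_of_abs_det_eq_one (f := consecutiveDiff n)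
      (by rw [det_consecutiveDiff, abs_one]) {z | _ ∧ _}]
  congr 1
  ext x
  have hlast : cyclicDiff n x (Fin.last n) = -∑ i, consecutiveDiff n x i := by
    have h := sum_cyclicDiff x
    rw [Fin.sum_univ_castSucc] at h
    exact (neg_eq_of_add_eq_zero_right h).symm
  have hsum : ∑ i, consecutiveDiff n x i =
      ∑ i, max (consecutiveDiff n x i) 0 - ∑ i, max (-consecutiveDiff n x i) 0 := by
    rw [← Finset.sum_sub_distrib]
    exact Finset.sum_congr rfl fun i _ => (max_zero_sub_max_neg_zero_eq_self _).symm
  have hasc : cyclicAscent x = max (∑ i, max (consecutiveDiff n x i) 0)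
      (∑ i, max (-consecutiveDiff n x i) 0) := by
    rw [cyclicAscent, Fin.sum_univ_castSucc, hlast, hsum]
    change ∑ i, max (consecutiveDiff n x i) 0 + _ = _
    rw [← max_add_add_left, add_zero, max_comm]
    congr 1
    ring
  simp [hasc]

/-- Type A_n in simple-root coordinates: (n+1) times the volume of the positive root
polytope equals the volume of the root polytope; equivalently the volume of the positive
root polytope is the n-th Catalan number divided by n!. -/
theorem typeA_positive_root_polytope_volume (n : ℕ) (hn : 1 ≤ n)
    (e : Fin n → (Fin n → ℝ))
    (he : ∀ i, e i = fun k => if k = i then (1 : ℝ) else 0)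
    (Φ'pos Φ' : Set (Fin n → ℝ))
    (hΦ'pos : Φ'pos = {v | ∃ i j : Fin n, i ≤ j ∧ v = ∑ k ∈ Finset.Icc i j, e k})
    (hΦ' : Φ' = Φ'pos ∪ (-Φ'pos)) :
    ((n : ENNReal) + 1) * MeasureTheory.volume (convexHull ℝ (Φ'pos ∪ {0}))
        = MeasureTheory.volume (convexHull ℝ Φ') ∧
    MeasureTheory.volume (convexHull ℝ (Φ'pos ∪ {0}))
        = (Nat.choose (2 * n) n : ENNReal)
            / (((n : ENNReal) + 1) * (Nat.factorial n : ENNReal)) := by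
  have hroot (i j : Fin n) :
      ∑ k ∈ Finset.Icc i j, e k = fun m => if i ≤ m ∧ m ≤ j then (1 : ℝ) else 0 := by
    ext m
    simp [he]
  obtain rfl : Φ'pos = positiveRootsA n := by simp only [hΦ'pos, hroot, positiveRootsA]
  have hmul := succ_mul_volume_ascentCorner n
  rw [hΦ', convexHull_positiveRootsA, convexHull_rootsA hn]
  refine ⟨hmul, ?_⟩
  rw [volume_cyclicAscent_le_one] at hmul
  have h0 : (n : ENNReal) + 1 ≠ 0 := by simp
  have htop : (n : ENNReal) + 1 ≠ ⊤ := by simp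
  rw [(ENNReal.eq_div_iff h0 htop).2 hmul, div_eq_mul_inv, div_eq_mul_inv, div_eq_mul_inv,
    ENNReal.mul_inv (.inl h0) (.inl htop), mul_assoc, mul_comm (n.factorial : ENNReal)⁻¹]
end
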